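/- Suppose d' = d and d/t is odd, where t is a positive divisor of d. Then, as (α,β) ranges over F_{p^m} × F_q, the codeword weight w(α,β) equals: (p^t−1)(p^{n−t}−p^{m−t}) for exactly p^d(p^m−1)(p^m+1)^2/(2(p^d+1)) pairs; (p^t−1)p^{n−t} for exactly p^{m−d}(p^n−1) pairs; (p^t−1)(p^{n−t}+p^{m−t}) for exactly p^d(p^m−1)(p^n−2p^{n−d}+1)/(2(p^d−1)) pairs; (p^t−1)(p^{n−t}+p^{m+d−t}) for exactly (p^{m−d}−1)(p^n−1)/(p^{2d}−1) pairs; and 0 for exactly 1 pair (namely (0,0)); w takes no other values. -/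

import Mathlib

open scoped BigOperators Classical

noncomputable section

/-- The map `φ_{α,β}(x) = α x^{p^m} + β x^{p^k} + β^{p^{n-k}} x^{p^{n-k}}`. -/
def phiMap (p m n k : ℕ) {F : Type} [Field F] (α β x : F) : F :=
  α * x ^ p ^ m + β * x ^ p ^ k + β ^ p ^ (n - k) * x ^ p ^ (n - k)

/-- The trace-type sum `x ↦ ∑_{i<r} x^{p^{t i}}`; for `x` in the subfield of size
`p^{t·r}` this is the relative trace down to the subfield of size `p^t`. -/
def trSum (p t r : ℕ) {F : Type} [Field F] (x : F) : F :=
  ∑ i ∈ Finset.range r, x ^ p ^ (t * i)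

/-- `ζ_p^c = exp(2πi·c̃/p)` for a lift `c̃` of `c : F_p`. -/
noncomputable def expChar (p : ℕ) (c : ZMod p) : ℂ :=
  Complex.exp (2 * Real.pi * Complex.I * (c.val : ℂ) / (p : ℂ))

/-- Identify an element of the prime field of `F` with an element of `ZMod p`
(the partial inverse of the algebra map). -/
noncomputable def fToZMod (p : ℕ) {F : Type} [Field F] [Algebra (ZMod p) F] (x : F) : ZMod p :=
  letI : Nonempty (ZMod p) := ⟨0⟩
  Function.invFun (algebraMap (ZMod p) F) x

/-- `T(α,β) = ∑_{x ∈ F_q} ζ_p^{Tr^m_1(α x^{p^m+1}) + Tr^n_1(β x^{p^k+1})}`. -/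
noncomputable def Tsum (p m n k : ℕ) (F : Type) [Field F] [Fintype F] [Algebra (ZMod p) F]
    (α β : F) : ℂ :=
  ∑ x : F, expChar p (fToZMod p (trSum p 1 m (α * x ^ (p ^ m + 1))) +
      fToZMod p (trSum p 1 n (β * x ^ (p ^ k + 1))))

/-- `S(α,β,γ) = ∑_{x ∈ F_q} ζ_p^{Tr^m_1(α x^{p^m+1}) + Tr^n_1(β x^{p^k+1} + γ x)}`. -/
noncomputable def Ssum (p m n k : ℕ) (F : Type) [Field F] [Fintype F] [Algebra (ZMod p) F]
    (α β γ : F) : ℂ :=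
  ∑ x : F, expChar p (fToZMod p (trSum p 1 m (α * x ^ (p ^ m + 1))) +
      fToZMod p (trSum p 1 n (β * x ^ (p ^ k + 1) + γ * x)))

/-- `√(q₀*)` where `q₀* = (−1)^{(q₀−1)/2} q₀`. -/
noncomputable def sqrtStar (q0 : ℕ) : ℂ :=
  if q0 % 4 = 1 then (Real.sqrt q0 : ℂ) else Complex.I * (Real.sqrt q0 : ℂ)

/-- `ζ_p = exp(2πi/p)`. -/
noncomputable def zetaC (p : ℕ) : ℂ := Complex.exp (2 * Real.pi * Complex.I / (p : ℂ))

/-- Number of pairs `(α,β) ∈ F_{p^m} × F_q` with `T(α,β) = v`. -/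
noncomputable def Tcount (p m n k : ℕ) (F : Type) [Field F] [Fintype F] [Algebra (ZMod p) F]
    (v : ℂ) : ℕ :=
  Nat.card {ab : F × F // ab.1 ^ p ^ m = ab.1 ∧ Tsum p m n k F ab.1 ab.2 = v}

/-- Number of triples `(α,β,γ) ∈ F_{p^m} × F_q × F_q` with `S(α,β,γ) = v`. -/
noncomputable def Scount (p m n k : ℕ) (F : Type) [Field F] [Fintype F] [Algebra (ZMod p) F]
    (v : ℂ) : ℕ :=
  Nat.card {abc : F × F × F // abc.1 ^ p ^ m = abc.1 ∧ Ssum p m n k F abc.1 abc.2.1 abc.2.2 = v}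

/-- Hamming weight of the codeword of `C₁` attached to `(α,β)`:
the number of `0 ≤ i ≤ q-2` with `Tr^m_t(α π^{i(p^m+1)}) + Tr^n_t(β π^{i(p^k+1)}) ≠ 0`. -/
noncomputable def wt1 (p m n k t : ℕ) {F : Type} [Field F] (π α β : F) : ℕ :=
  Nat.card {i : ℕ // i ≤ p ^ n - 2 ∧
    trSum p t (m / t) (α * π ^ (i * (p ^ m + 1))) +
    trSum p t (n / t) (β * π ^ (i * (p ^ k + 1))) ≠ 0}

/-- Number of pairs `(α,β) ∈ F_{p^m} × F_q` whose `C₁`-codeword has weight `v`. -/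
noncomputable def wt1count (p m n k t : ℕ) (F : Type) [Field F] [Fintype F] (π : F) (v : ℕ) : ℕ :=
  Nat.card {ab : F × F // ab.1 ^ p ^ m = ab.1 ∧ wt1 p m n k t π ab.1 ab.2 = v}

/-- Hamming weight of the codeword of `C₂` attached to `(α,β,γ)`. -/
noncomputable def wt2 (p m n k t : ℕ) {F : Type} [Field F] (π α β γ : F) : ℕ :=
  Nat.card {i : ℕ // i ≤ p ^ n - 2 ∧
    trSum p t (m / t) (α * π ^ (i * (p ^ m + 1))) +
    trSum p t (n / t) (β * π ^ (i * (p ^ k + 1)) + γ * π ^ i) ≠ 0}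

/-- Number of triples `(α,β,γ)` whose `C₂`-codeword has weight `v`. -/
noncomputable def wt2count (p m n k t : ℕ) (F : Type) [Field F] [Fintype F] (π : F) (v : ℕ) : ℕ :=
  Nat.card {abc : F × F × F // abc.1 ^ p ^ m = abc.1 ∧ wt2 p m n k t π abc.1 abc.2.1 abc.2.2 = v}

/-- Squares together with a fixed nonsquare multiple of the squares cover a finite field of odd
characteristic twice. -/
lemma sum_comp_sq_add_sum_comp_nonsquare_mul_sq {L : Type*} [Field L] [Fintype L]
    (h2 : (2 : L) ≠ 0) {ν : L} (hν : ¬ IsSquare ν) (f : L → ℂ) :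
    ∑ x, f (x ^ 2) + ∑ x, f (ν * x ^ 2) = 2 * ∑ x, f x := by
  have hchar : ringChar L ≠ 2 := by
    intro h; exact h2 (by exact_mod_cast h ▸ CharP.cast_eq_zero L (ringChar L))
  have hν0 : ν ≠ 0 := by rintro rfl; exact hν (IsSquare.zero)
  have hcard (y : L) : ((Finset.univ.filter fun x : L => x ^ 2 = y).card : ℂ)
      = ((quadraticChar L y : ℤ) : ℂ) + 1 := by
    have h := quadraticChar_card_sqrts hchar y
    have h' : {x : L | x ^ 2 = y}.toFinset = Finset.univ.filter fun x : L => x ^ 2 = y := by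
      ext; simp
    rw [h'] at h
    exact_mod_cast h
  have key (g : L → ℂ) : ∑ x, g (x ^ 2) = ∑ y, (((quadraticChar L y : ℤ) : ℂ) + 1) * g y := by
    rw [← Finset.sum_fiberwise_of_maps_to (s := Finset.univ) (t := Finset.univ)
      (g := fun x : L => x ^ 2) (fun _ _ => Finset.mem_univ _)]
    refine Finset.sum_congr rfl fun y _ => ?_
    rw [Finset.sum_congr rfl (g := fun _ => g y)
      (fun x hx => by rw [(Finset.mem_filter.mp hx).2]), Finset.sum_const, nsmul_eq_mul, hcard]
  have hinv : ∑ y, (((quadraticChar L y : ℤ) : ℂ) + 1) * f (ν * y)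
      = ∑ y, (-((quadraticChar L y : ℤ) : ℂ) + 1) * f y := by
    refine Fintype.sum_equiv (Equiv.mulLeft₀ ν hν0) _ _ fun y => ?_
    simp only [Equiv.mulLeft₀_apply, map_mul, quadraticChar_neg_one_iff_not_isSquare.mpr hν]
    push_cast; ring
  rw [key f, key fun y => f (ν * y), hinv, ← Finset.sum_add_distrib, Finset.mul_sum]
  exact Finset.sum_congr rfl fun y _ => by ring

/-- The sum `∑ ψ (a x²)`. -/
def quadSum {L : Type*} [Field L] [Fintype L] (ψ : AddChar L ℂ) (a : L) : ℂ :=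
  ∑ x : L, ψ (a * x ^ 2)

lemma AddChar.sum_mul_eq_zero {L : Type*} [Field L] [Fintype L] {ψ : AddChar L ℂ} (hψ : ψ ≠ 1)
    {a : L} (ha : a ≠ 0) : ∑ x, ψ (a * x) = 0 := by
  rw [← AddChar.sum_eq_zero_of_ne_one hψ]
  exact Fintype.sum_equiv (Equiv.mulLeft₀ a ha) _ _ fun _ => rfl

lemma quadSum_nonsquare_mul {L : Type*} [Field L] [Fintype L] (h2 : (2 : L) ≠ 0)
    {ψ : AddChar L ℂ} (hψ : ψ ≠ 1) {ν a : L} (hν : ¬ IsSquare ν) (ha : a ≠ 0) :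
    quadSum ψ (ν * a) = -quadSum ψ a := by
  have h := sum_comp_sq_add_sum_comp_nonsquare_mul_sq h2 hν fun x => ψ (a * x)
  rw [AddChar.sum_mul_eq_zero hψ ha, mul_zero] at h
  rw [eq_neg_iff_add_eq_zero, add_comm, ← h]
  simp only [quadSum]
  congr 1
  exact Finset.sum_congr rfl fun x _ => by ring_nf

lemma quadSum_square_mul {L : Type*} [Field L] [Fintype L]
    (ψ : AddChar L ℂ) {s : L} (a : L) (hs : IsSquare s) (hs0 : s ≠ 0) :
    quadSum ψ (s * a) = quadSum ψ a := by
  obtain ⟨r, rfl⟩ := hs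
  have hr : r ≠ 0 := by rintro rfl; simp at hs0
  exact Fintype.sum_equiv (Equiv.mulLeft₀ r hr) _ _ fun x => by
    simp only [Equiv.mulLeft₀_apply]; ring_nf

lemma quadSum_mul_quadSum_neg {L : Type*} [Field L] [Fintype L] (h2 : (2 : L) ≠ 0)
    {ψ : AddChar L ℂ} (hψ : ψ ≠ 1) {a : L} (ha : a ≠ 0) :
    quadSum ψ a * quadSum ψ (-a) = Fintype.card L := by
  have hinner (z : L) : ∑ x, ψ ((-2 * a * z) * x) = if z = 0 then (Fintype.card L : ℂ) else 0 := by
    split_ifs with hz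
    · simp [hz]
    · exact AddChar.sum_mul_eq_zero hψ (by simp [h2, ha, hz])
  calc quadSum ψ a * quadSum ψ (-a)
      = ∑ x, ∑ y, ψ (a * x ^ 2 - a * y ^ 2) := by
        simp only [quadSum, Finset.sum_mul_sum, ← AddChar.map_add_eq_mul]
        exact Finset.sum_congr rfl fun x _ => Finset.sum_congr rfl fun y _ => by ring_nf
    _ = ∑ x, ∑ z, ψ (-a * z ^ 2) * ψ ((-2 * a * z) * x) := by
        refine Finset.sum_congr rfl fun x _ => ?_
        refine Fintype.sum_equiv (Equiv.subRight x) _ _ fun y => ?_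
        rw [← AddChar.map_add_eq_mul, Equiv.subRight_apply]
        ring_nf
    _ = Fintype.card L := by
        rw [Finset.sum_comm]
        simp only [← Finset.mul_sum, hinner, mul_ite, mul_zero]
        simp

/-- A quadratic sum over the units equals `±` the standard one. -/
lemma quadSum_mul_quadSum_of_ne_zero {L : Type*} [Field L] [Fintype L] (h2 : (2 : L) ≠ 0)
    {ψ : AddChar L ℂ} (hψ : ψ ≠ 1) {a : L} (ha : a ≠ 0) :
    quadSum ψ a = quadSum ψ 1 ∨ quadSum ψ a = -quadSum ψ 1 := by
  by_cases h : IsSquare a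
  · left; simpa using quadSum_square_mul ψ 1 h ha
  · right; simpa using quadSum_nonsquare_mul h2 hψ h one_ne_zero

/-- The number of zeros of a function is detected by additive characters. -/
lemma card_mul_card_zeros {K V : Type*} [Field K] [Fintype K] [Fintype V] {ψ : AddChar K ℂ}
    (hψ : ψ ≠ 1) (f : V → K) :
    (Fintype.card K : ℂ) * (Finset.univ.filter fun v => f v = 0).card
      = Fintype.card V + ∑ c ∈ Finset.univ.filter (fun c : K => c ≠ 0), ∑ v, ψ (c * f v) := by
  have h1 (v : V) : ∑ c : K, ψ (c * f v) = if f v = 0 then (Fintype.card K : ℂ) else 0 := by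
    split_ifs with h
    · simp [h]
    · simp only [mul_comm _ (f v)]; exact AddChar.sum_mul_eq_zero hψ h
  have h2 : ∑ c : K, ∑ v, ψ (c * f v)
      = (Fintype.card K : ℂ) * (Finset.univ.filter fun v => f v = 0).card := by
    rw [Finset.sum_comm]
    simp only [h1]
    rw [← Finset.sum_filter, Finset.sum_const, nsmul_eq_mul, mul_comm]
  rw [← h2, ← Finset.add_sum_erase _ _ (Finset.mem_univ (0 : K))]
  congr 1
  · simp
  · exact Finset.sum_congr (by ext; simp) fun _ _ => rfl

/-- The character sums of a nondegenerate quadratic form in an even number of variables. -/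
lemma exists_sum_char_quadraticForm {K V : Type*} [Field K] [Fintype K] (h2 : (2 : K) ≠ 0)
    [AddCommGroup V] [Module K V] [Fintype V] {ψ : AddChar K ℂ} (hψ : ψ ≠ 1)
    (Q : QuadraticForm K V) (hQ : ∀ x, (∀ y, QuadraticMap.polar Q x y = 0) → x = 0) {r : ℕ}
    (hr : Module.finrank K V = 2 * r) :
    ∃ ε : ℤ, (ε = 1 ∨ ε = -1) ∧
      ∀ c : K, c ≠ 0 → ∑ v, ψ (c * Q v) = ε * (Fintype.card K : ℂ) ^ r := by
  have : Invertible (2 : K) := invertibleOfNonzero h2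
  obtain ⟨w, ⟨e⟩⟩ := QuadraticForm.equivalent_weightedSumSquares_units_of_nondegenerate' Q (by
    intro x hx
    refine hQ x fun y => ?_
    rw [← QuadraticMap.polarBilin_apply_apply, ← QuadraticMap.two_nsmul_associated K,
      LinearMap.smul_apply, LinearMap.smul_apply, hx y, smul_zero])
  have hsum (c : K) : ∑ v, ψ (c * Q v) = ∏ i, quadSum ψ (c * (w i : K)) := by
    have hprod {ι : Type} (s : Finset ι) (f : ι → K) : ψ (∑ i ∈ s, f i) = ∏ i ∈ s, ψ (f i) := by
      induction s using Finset.induction_on with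
      | empty => simp
      | insert a s ha ih => rw [Finset.sum_insert ha, Finset.prod_insert ha,
          AddChar.map_add_eq_mul, ih]
    calc ∑ v, ψ (c * Q v) = ∑ x : Fin (Module.finrank K V) → K, ∏ i, ψ (c * w i * x i ^ 2) := by
          refine Fintype.sum_equiv e.toEquiv _ _ fun v => ?_
          rw [← e.map_app v, QuadraticMap.weightedSumSquares_apply, Finset.mul_sum, hprod]
          refine Finset.prod_congr rfl fun i _ => ?_
          rw [Units.smul_def, smul_eq_mul, ← sq, ← mul_assoc]
          rfl
      _ = _ := by
          simp only [quadSum]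
          rw [Finset.prod_univ_sum]
          simp
  have hstd : ∃ δ : ℤ, (δ = 1 ∨ δ = -1) ∧ ∏ i, quadSum ψ (w i : K)
      = δ * quadSum ψ 1 ^ Module.finrank K V := by
    have (s : Finset (Fin (Module.finrank K V))) : ∃ δ : ℤ, (δ = 1 ∨ δ = -1) ∧
        ∏ i ∈ s, quadSum ψ (w i : K) = δ * quadSum ψ 1 ^ s.card := by
      induction s using Finset.induction_on with
      | empty => exact ⟨1, by simp⟩
      | insert a s ha ih =>
        obtain ⟨δ, hδ, h⟩ := ih
        rw [Finset.prod_insert ha, Finset.card_insert_of_notMem ha, h]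
        rcases quadSum_mul_quadSum_of_ne_zero h2 hψ (w a).ne_zero with h' | h' <;> rw [h']
        · exact ⟨δ, hδ, by ring⟩
        · exact ⟨-δ, by omega, by push_cast; ring⟩
    simpa using this Finset.univ
  obtain ⟨δ, hδ, hδw⟩ := hstd
  have hpow : (-1 : ℂ) ^ Module.finrank K V = 1 := by rw [hr, pow_mul]; simp
  have hscale {c : K} (hc : c ≠ 0) :
      ∏ i, quadSum ψ (c * (w i : K)) = ∏ i, quadSum ψ (w i : K) := by
    by_cases h : IsSquare c
    · exact Finset.prod_congr rfl fun i _ => quadSum_square_mul ψ _ h hc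
    · rw [Finset.prod_congr rfl fun i _ => quadSum_nonsquare_mul h2 hψ h (w i).ne_zero,
        Finset.prod_neg, Finset.card_univ, Fintype.card_fin, hpow, one_mul]
  have hsq : ∃ η : ℤ, (η = 1 ∨ η = -1) ∧ quadSum ψ 1 ^ 2 = η * (Fintype.card K : ℂ) := by
    have h := quadSum_mul_quadSum_neg h2 hψ one_ne_zero
    rcases quadSum_mul_quadSum_of_ne_zero h2 hψ (neg_ne_zero.mpr one_ne_zero) with h' | h' <;>
      rw [h'] at h
    · exact ⟨1, by simp, by rw [← h]; push_cast; ring⟩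
    · exact ⟨-1, by simp, by rw [← h]; push_cast; ring⟩
  obtain ⟨η, hη, hηq⟩ := hsq
  refine ⟨δ * η ^ r, ?_, fun c hc => ?_⟩
  · have : η ^ r = 1 ∨ η ^ r = -1 := by
      rcases hη with rfl | rfl
      · simp
      · exact neg_one_pow_eq_or ℤ r
    rcases hδ with rfl | rfl <;> rcases this with h | h <;> simp [h]
  · rw [hsum, hscale hc, hδw, hr, pow_mul, hηq, mul_pow]
    push_cast; ring

/-- The elements fixed by an automorphism. -/
def fixedSub {K F : Type*} [Field K] [Field F] [Algebra K F] (τ : F ≃ₐ[K] F) :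
    IntermediateField K F where
  carrier := {x | τ x = x}
  mul_mem' := fun {a b} ha hb => by simp_all
  add_mem' := fun {a b} ha hb => by simp_all
  algebraMap_mem' := by simp
  inv_mem' := fun x hx => by simp_all

@[simp] lemma mem_fixedSub {K F : Type*} [Field K] [Field F] [Algebra K F] {τ : F ≃ₐ[K] F}
    {x : F} : x ∈ fixedSub τ ↔ τ x = x := Iff.rfl

/-- Commuting automorphisms `σ`, `ι` of a field of characteristic not two, `ι` being a nontrivial
involution, without common nonzero anti-invariants. -/
structure CommutingPair {K F : Type*} [Field K] [Field F] [Algebra K F]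
    (σ ι : F ≃ₐ[K] F) : Prop where
  two_ne_zero : (2 : F) ≠ 0
  invol : ∀ x, ι (ι x) = x
  comm : ∀ x, ι (σ x) = σ (ι x)
  eq_zero_of_anti : ∀ v, ι v = -v → σ v = -v → v = 0
  exists_anti : ∃ θ, θ ≠ 0 ∧ ι θ = -θ

/-- The function whose trace is the quadratic form attached to `(α, β)`. -/
def pairForm {K F : Type*} [Field K] [Field F] [Algebra K F] (σ ι : F ≃ₐ[K] F) (α β x : F) : F :=
  α * (x * ι x) / 2 + β * (x * σ x)

/-- The linearization of the quadratic form attached to `(α, β)`. -/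
def pairLin {K F : Type*} [Field K] [Field F] [Algebra K F] (σ ι : F ≃ₐ[K] F) (α β x : F) : F :=
  α * ι x + β * σ x + σ.symm (β * x)

/-- First coordinate of the pair with kernel element `x` and parameter `u`. -/
def alphaOf {K F : Type*} [Field K] [Field F] [Algebra K F] (σ ι : F ≃ₐ[K] F) (x u : F) : F :=
  -(u + σ.symm u) / (x * ι x)

/-- Second coordinate of the pair with kernel element `x` and parameter `u`. -/
def betaOf {K F : Type*} [Field K] [Field F] [Algebra K F] (σ : F ≃ₐ[K] F) (x u : F) : F :=
  u / (x * σ x)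

namespace CommutingPair

variable {K F : Type*} [Field K] [Field F] [Algebra K F] {σ ι : F ≃ₐ[K] F}

lemma pairLin_mul_self {x : F} (hx : x ≠ 0) (u z : F) :
    pairLin σ ι (alphaOf σ ι x u) (betaOf σ x u) (x * z) * x
      = -(u + σ.symm u) * ι z + u * σ z + σ.symm (u * z) := by
  have hιx : ι x ≠ 0 := by simpa using hx
  have hσx : σ x ≠ 0 := by simpa using hx
  have h1 : σ.symm (betaOf σ x u * (x * z)) * x = σ.symm (u * z) := by
    apply σ.injective
    simp [betaOf]
    field_simp
  rw [pairLin, add_mul, h1]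
  simp only [alphaOf, betaOf, map_mul]
  field_simp

lemma pairForm_mul {x : F} (hx : x ≠ 0) (u z : F) :
    pairForm σ ι (alphaOf σ ι x u) (betaOf σ x u) (x * z)
      = -(u + σ.symm u) * (z * ι z) / 2 + u * (z * σ z) := by
  have hιx : ι x ≠ 0 := by simpa using hx
  have hσx : σ x ≠ 0 := by simpa using hx
  simp only [pairForm, alphaOf, betaOf, map_mul]
  field_simp

section algebra

variable (h : CommutingPair σ ι)
include h

lemma comm_symm (x : F) : ι (σ.symm x) = σ.symm (ι x) := by
  apply σ.injective
  rw [← h.comm]; simp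

/-- A nonzero kernel element `x` of the linearization determines `u = β x σ(x)` in the
fixed field of `ι`. -/
lemma eq_alphaOf_betaOf {α β x : F} (hα : ι α = α) (hx : x ≠ 0)
    (hker : pairLin σ ι α β x = 0) :
    ι (β * (x * σ x)) = β * (x * σ x) ∧ α = alphaOf σ ι x (β * (x * σ x)) ∧
      β = betaOf σ x (β * (x * σ x)) := by
  have hιx : ι x ≠ 0 := by simpa using hx
  have hσx : σ x ≠ 0 := by simpa using hx
  set u := β * (x * σ x) with hu
  have h1 : α * (x * ι x) + u + σ.symm u = 0 := by
    have : σ.symm u = σ.symm (β * x) * x := by simp [hu, mul_assoc]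
    rw [this, hu]
    rw [pairLin] at hker
    linear_combination x * hker
  have h2 : α * (x * ι x) + ι u + σ.symm (ι u) = 0 := by
    have := congrArg ι h1
    simp only [map_add, map_mul, h.invol, hα, h.comm_symm, map_zero] at this
    linear_combination this
  refine ⟨?_, ?_, ?_⟩
  · have h3 := h.eq_zero_of_anti (ι u - u) (by simp [h.invol]) (by
      have : σ.symm (ι u - u) = -(ι u - u) := by
        rw [map_sub]; linear_combination h2 - h1
      have := congrArg σ this
      simp only [AlgEquiv.apply_symm_apply, map_neg] at this
      rw [eq_comm, neg_eq_iff_eq_neg]; exact this)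
    exact sub_eq_zero.mp h3
  · rw [alphaOf, eq_div_iff (mul_ne_zero hx hιx)]
    linear_combination h1
  · rw [betaOf, hu]; field_simp

lemma map_alphaOf {x u : F} (hu : ι u = u) : ι (alphaOf σ ι x u) = alphaOf σ ι x u := by
  simp [alphaOf, h.invol, h.comm_symm, hu, mul_comm]

/-- The kernel of the linearization, relative to the kernel element `x`. -/
lemma pairLin_eq_zero_iff {x u : F} (hx : x ≠ 0) (hu : ι u = u) (hu0 : u ≠ 0) (z : F) :
    pairLin σ ι (alphaOf σ ι x u) (betaOf σ x u) (x * z) = 0 ↔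
      ι z = z ∧ σ (u * (σ z - z)) = u * (σ z - z) := by
  have h2 := h.two_ne_zero
  have hkey : pairLin σ ι (alphaOf σ ι x u) (betaOf σ x u) (x * z) = 0 ↔
      -(u + σ.symm u) * ι z + u * σ z + σ.symm (u * z) = 0 := by
    rw [← pairLin_mul_self hx, mul_eq_zero, or_iff_left hx]
  rw [hkey]
  constructor
  · intro h1
    have h1' : -(u + σ.symm u) * z + u * σ (ι z) + σ.symm (u * ι z) = 0 := by
      have := congrArg ι h1
      simpa [h.invol, h.comm_symm, h.comm, hu] using this
    have hv : u * (z - ι z + σ (z - ι z)) = 0 := by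
      apply h.eq_zero_of_anti
      · simp [h.invol, h.comm, hu]; ring
      · have : σ.symm (u * (z - ι z + σ (z - ι z))) = -(u * (z - ι z + σ (z - ι z))) := by
          simp only [map_mul, map_add, map_sub, AlgEquiv.symm_apply_apply] at h1 h1' ⊢
          linear_combination h1 - h1'
        have := congrArg σ this
        simp only [AlgEquiv.apply_symm_apply, map_neg] at this
        rw [eq_comm, neg_eq_iff_eq_neg]; exact this
    have hz : z - ι z = 0 := by
      apply h.eq_zero_of_anti
      · simp [h.invol]
      · have := (mul_eq_zero.mp hv).resolve_left hu0
        linear_combination this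
    have hz' : ι z = z := (sub_eq_zero.mp hz).symm
    refine ⟨hz', ?_⟩
    rw [hz'] at h1
    have : σ.symm (u * (σ z - z)) = u * (σ z - z) := by
      simp only [map_mul, map_sub, AlgEquiv.symm_apply_apply] at h1 ⊢
      linear_combination -h1
    have := congrArg σ this
    rw [AlgEquiv.apply_symm_apply] at this
    exact this.symm
  · rintro ⟨hz, h1⟩
    have : u * (σ z - z) = σ.symm (u * (σ z - z)) := by
      rw [← h1, AlgEquiv.symm_apply_apply, h1]
    rw [hz]
    simp only [map_mul, map_sub, AlgEquiv.symm_apply_apply] at this ⊢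
    linear_combination this

end algebra

end CommutingPair

/-- Restriction of an additive character to an intermediate field. -/
def AddChar.restrictTo {K F : Type*} [Field K] [Field F] [Algebra K F] (χ : AddChar F ℂ)
    (E : IntermediateField K F) : AddChar E ℂ :=
  χ.compAddMonoidHom (algebraMap E F).toAddMonoidHom

@[simp] lemma AddChar.restrictTo_apply {K F : Type*} [Field K] [Field F] [Algebra K F]
    (χ : AddChar F ℂ) (E : IntermediateField K F) (x : E) : χ.restrictTo E x = χ (x : F) := rfl

namespace CommutingPair

variable {K F : Type*} [Field K] [Field F] [Algebra K F] {σ ι : F ≃ₐ[K] F}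

lemma two_ne_zero_of_intermediateField (h : CommutingPair σ ι) (S : IntermediateField K F) :
    (2 : S) ≠ 0 := by
  intro h0
  have := congrArg (algebraMap S F) h0
  rw [map_ofNat, map_zero] at this
  exact h.two_ne_zero this

section sums

variable [Fintype F] {χ : AddChar F ℂ}

omit [Fintype F] in
lemma char_eq_one_of_anti (h : CommutingPair σ ι) (hι : ∀ x, χ (ι x) = χ x) {y : F}
    (hy : ι y = -y) : χ y = 1 := by
  have h2 := h.two_ne_zero
  have h1 : ι (y / 2) = -(y / 2) := by rw [map_div₀, hy, map_ofNat]; ring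
  have : χ (y / 2 + y / 2) = χ (y / 2 + -(y / 2)) := by
    rw [AddChar.map_add_eq_mul, AddChar.map_add_eq_mul, ← h1, hι]
  rw [add_neg_cancel, AddChar.map_zero_eq_one] at this
  rw [← this]; congr 1; field_simp; norm_num

/-- Decomposition of the field along `1, θ` for an anti-invariant `θ`. -/
lemma sum_eq_sum_sum (h : CommutingPair σ ι) {θ : F} (hθ : θ ≠ 0) (hιθ : ι θ = -θ) (f : F → ℂ) :
    ∑ x, f x = ∑ a : fixedSub ι, ∑ b : fixedSub ι, f (a + θ * b) := by
  have h2 := h.two_ne_zero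
  rw [← Fintype.sum_prod_type']
  symm
  refine Fintype.sum_bijective (fun ab : fixedSub ι × fixedSub ι => (ab.1 : F) + θ * ab.2)
    ⟨?_, ?_⟩ _ _ fun _ => rfl
  · rintro ⟨⟨a, ha⟩, ⟨b, hb⟩⟩ ⟨⟨a', ha'⟩, ⟨b', hb'⟩⟩ h1
    simp only [mem_fixedSub] at ha hb ha' hb'
    simp only at h1
    have h3 := congrArg ι h1
    simp only [map_add, map_mul, ha, hb, ha', hb', hιθ] at h3
    have h4 : a = a' := by
      apply mul_left_cancel₀ h2; linear_combination h1 + h3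
    have h5 : b = b' := by
      apply mul_left_cancel₀ (mul_ne_zero h2 hθ); linear_combination h1 - h3
    simp [h4, h5]
  · intro x
    refine ⟨⟨⟨(x + ι x) / 2, ?_⟩, ⟨(x - ι x) / (2 * θ), ?_⟩⟩, ?_⟩
    · simp [h.invol, add_comm, map_ofNat]
    · simp only [mem_fixedSub, map_div₀, map_sub, map_mul, h.invol, hιθ, map_ofNat]
      field_simp; ring
    · simp only; field_simp; ring

omit [Fintype F] in
lemma restrictTo_ne_one (h : CommutingPair σ ι) (hχ : χ ≠ 1) (hι : ∀ x, χ (ι x) = χ x) :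
    χ.restrictTo (fixedSub ι) ≠ 1 := by
  have h2 := h.two_ne_zero
  intro h1
  apply hχ
  rw [AddChar.eq_one_iff] at h1 ⊢
  intro x
  have hx : x = (x + ι x) / 2 + (x - ι x) / 2 := by field_simp; ring
  have ha := h1 ⟨(x + ι x) / 2, by simp [h.invol, add_comm, map_ofNat]⟩
  rw [AddChar.restrictTo_apply] at ha
  rw [hx, AddChar.map_add_eq_mul, ha, one_mul]
  exact h.char_eq_one_of_anti hι (by simp only [map_div₀, map_sub, h.invol, map_ofNat]; ring)

/-- The common fixed field. -/
abbrev commonFixed (σ ι : F ≃ₐ[K] F) : IntermediateField K F := fixedSub σ ⊓ fixedSub ι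

/-- The fibres of `a ↦ σ a - a` on the fixed field of `ι` are counted by character sums over the
common fixed field. -/
lemma sum_char_eq_card_fiber (h : CommutingPair σ ι) (hχ : χ ≠ 1) (hι : ∀ x, χ (ι x) = χ x)
    (hσ : ∀ x, χ (σ x) = χ x) (c : fixedSub ι) :
    ∑ l : commonFixed σ ι, χ (l * c)
      = (Finset.univ.filter fun a : fixedSub ι => σ (a : F) - a = c).card := by
  let D : fixedSub ι → fixedSub ι := fun a =>
    ⟨σ (a : F) - a, by rw [mem_fixedSub, map_sub, h.comm, a.2]⟩
  let N : fixedSub ι → ℕ := fun c => (Finset.univ.filter fun a : fixedSub ι => D a = c).card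
  let R : fixedSub ι → ℕ := fun c =>
    if ∀ l : commonFixed σ ι, χ (l * c) = 1 then Fintype.card (commonFixed σ ι) else 0
  have hR (c : fixedSub ι) : ∑ l : commonFixed σ ι, χ (l * c) = R c := by
    let ξ : AddChar (commonFixed σ ι) ℂ :=
      χ.compAddMonoidHom ((AddMonoidHom.mulRight (c : F)).comp
        (algebraMap (commonFixed σ ι) F).toAddMonoidHom)
    have hξ : ∑ l : commonFixed σ ι, χ (l * c) = ∑ l, ξ l := rfl
    have hξ1 : ξ = 0 ↔ ∀ l : commonFixed σ ι, χ (l * c) = 1 := AddChar.eq_zero_iff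
    rw [hξ, AddChar.sum_eq_ite]
    simp only [hξ1, R]
    split_ifs <;> simp
  have hNR (c : fixedSub ι) : N c ≤ R c := by
    by_cases hc : ∃ a, D a = c
    · obtain ⟨a, rfl⟩ := hc
      have h1 : ∀ l : commonFixed σ ι, χ (l * (D a : F)) = 1 := by
        intro l
        have hl : σ (l : F) = l := l.2.1
        have : (l : F) * (D a : F) = σ (l * a) + -(l * a) := by simp [D, hl]; ring
        rw [this, AddChar.map_add_eq_mul, hσ, ← AddChar.map_add_eq_mul]
        simp
      simp only [R, if_pos h1, N]
      rw [← Fintype.card_coe]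
      refine Fintype.card_le_of_injective (fun b => (⟨(b : fixedSub ι) - a, ?_, ?_⟩ :
        commonFixed σ ι)) ?_
      · have hb := congrArg Subtype.val (Finset.mem_filter.mp b.2).2
        simp only [D] at hb
        simp only [SetLike.mem_coe]
        show σ _ = _
        rw [map_sub]; linear_combination hb
      · show ι _ = _
        rw [map_sub, b.1.2, a.2]
      · intro b b' hbb
        have h3 := congrArg Subtype.val hbb
        simp only [sub_left_inj] at h3
        exact Subtype.ext (Subtype.ext h3)
    · have : N c = 0 := by
        simp only [N, Finset.card_eq_zero, Finset.filter_eq_empty_iff]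
        exact fun a _ ha => hc ⟨a, ha⟩
      omega
  have hsumN : ∑ c, N c = Fintype.card (fixedSub ι) := by
    rw [← Finset.card_univ]
    exact (Finset.card_eq_sum_card_fiberwise fun _ _ => Finset.mem_univ _).symm
  have hsumR : ∑ c, R c = Fintype.card (fixedSub ι) := by
    have : ((∑ c, R c : ℕ) : ℂ) = Fintype.card (fixedSub ι) := by
      push_cast
      simp only [← hR]
      rw [Finset.sum_comm, Finset.sum_eq_single (0 : commonFixed σ ι)]
      · simp
      · intro l _ hl
        have hl' : (⟨l, l.2.2⟩ : fixedSub ι) ≠ 0 := by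
          intro h0
          have h3 : (l : F) = 0 := congrArg Subtype.val h0
          exact hl (Subtype.ext h3)
        exact AddChar.sum_mul_eq_zero (h.restrictTo_ne_one hχ hι) hl'
      · simp
    exact_mod_cast this
  have heq := (Finset.sum_eq_sum_iff_of_le fun c _ => hNR c).mp (hsumN.trans hsumR.symm) c
    (Finset.mem_univ c)
  rw [hR, ← heq]
  simp only [N, D]
  congr 2
  ext a
  simp [Subtype.ext_iff]

lemma sum_char_invariant_part (h : CommutingPair σ ι) (hχ : χ ≠ 1) (hι : ∀ x, χ (ι x) = χ x)
    (hσ : ∀ x, χ (σ x) = χ x) {w : fixedSub ι} (hw : w ≠ 0) :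
    ∑ a : fixedSub ι, χ (-(w * (σ a - a) ^ 2))
      = (∑ l : commonFixed σ ι, χ (l ^ 2 / (4 * w))) * quadSum (χ.restrictTo (fixedSub ι)) (-w) := by
  have h2 := h.two_ne_zero
  have hw' : (w : F) ≠ 0 := by simpa using hw
  have h4 : (4 : F) ≠ 0 := by
    have : (4 : F) = 2 * 2 := by norm_num
    rw [this]; exact mul_ne_zero h2 h2
  let D : fixedSub ι → fixedSub ι := fun a =>
    ⟨σ (a : F) - a, by rw [mem_fixedSub, map_sub, h.comm, a.2]⟩
  have hD (c : fixedSub ι) : ((Finset.univ.filter fun a => D a = c).card : ℂ)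
      = ∑ l : commonFixed σ ι, χ (l * c) := by
    rw [h.sum_char_eq_card_fiber hχ hι hσ]
    congr 2; ext a; simp [Subtype.ext_iff, D]
  calc ∑ a : fixedSub ι, χ (-(w * (σ a - a) ^ 2))
      = ∑ c : fixedSub ι, ∑ l : commonFixed σ ι, χ (l * c) * χ (-(w * c ^ 2)) := by
        rw [← Finset.sum_fiberwise_of_maps_to (s := Finset.univ) (t := Finset.univ)
          (g := D) (fun _ _ => Finset.mem_univ _)]
        refine Finset.sum_congr rfl fun c _ => ?_
        rw [Finset.sum_congr rfl (g := fun _ => χ (-(w * c ^ 2)))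
          (fun x hx => by rw [← (Finset.mem_filter.mp hx).2]), Finset.sum_const, nsmul_eq_mul, hD,
          Finset.sum_mul]
    _ = ∑ l : commonFixed σ ι, ∑ c : fixedSub ι,
          χ (l ^ 2 / (4 * w)) * χ (-w * (c - l / (2 * w)) ^ 2) := by
        rw [Finset.sum_comm]
        refine Finset.sum_congr rfl fun l _ => Finset.sum_congr rfl fun c _ => ?_
        rw [← AddChar.map_add_eq_mul, ← AddChar.map_add_eq_mul]
        congr 1; field_simp; ring
    _ = _ := by
        rw [Finset.sum_mul]
        refine Finset.sum_congr rfl fun l _ => ?_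
        rw [← Finset.mul_sum, quadSum]
        congr 1
        have hl : ι (l : F) = l := l.2.2
        refine Fintype.sum_equiv (Equiv.subRight (⟨l / (2 * w), by
          rw [mem_fixedSub, map_div₀, hl, map_mul, w.2, map_ofNat]⟩ : fixedSub ι)) _ _ fun c => ?_
        simp

lemma sum_char_anti_part (h : CommutingPair σ ι) (hχ : χ ≠ 1) (hι : ∀ x, χ (ι x) = χ x)
    {θ : F} (hθ : θ ≠ 0) (hιθ : ι θ = -θ) {w : fixedSub ι} (hw : w ≠ 0) :
    ∑ b : fixedSub ι, χ (w * (θ * b + σ (θ * b)) ^ 2)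
      = -quadSum (χ.restrictTo (fixedSub ι)) w := by
  have h2 := h.two_ne_zero
  have hmem (b : fixedSub ι) : (θ * b + σ (θ * b)) / θ ∈ fixedSub ι := by
    rw [mem_fixedSub, map_div₀, map_add, h.comm, map_mul, hιθ, b.2, neg_mul, map_neg, div_neg]
    ring
  let Θ : fixedSub ι → fixedSub ι := fun b => ⟨(θ * b + σ (θ * b)) / θ, hmem b⟩
  have hΘ : Function.Injective Θ := by
    intro b b' hbb
    have h1 := congrArg Subtype.val hbb
    simp only [Θ] at h1
    rw [div_left_inj' hθ] at h1
    have h3 := h.eq_zero_of_anti (θ * (b - b')) (by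
      rw [map_mul, map_sub, hιθ, b.2, b'.2]; ring) (by
      simp only [map_mul, map_sub] at h1 ⊢
      linear_combination h1)
    have := (mul_eq_zero.mp h3).resolve_left hθ
    exact Subtype.ext (sub_eq_zero.mp this)
  let ν : fixedSub ι := ⟨θ ^ 2, by rw [mem_fixedSub, map_pow, hιθ]; ring⟩
  have hν : ¬ IsSquare ν := by
    rintro ⟨s, hs⟩
    have hs' : θ ^ 2 = (s : F) ^ 2 := by
      have := congrArg Subtype.val hs
      simpa [ν, sq] using this
    have h3 : ι θ = θ := by
      rcases sq_eq_sq_iff_eq_or_eq_neg.mp hs' with h3 | h3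
      · rw [h3]; exact s.2
      · rw [h3, map_neg, s.2]
    rw [hιθ, neg_eq_iff_add_eq_zero, ← two_mul] at h3
    exact (mul_ne_zero h2 hθ) h3
  rw [← quadSum_nonsquare_mul (h.two_ne_zero_of_intermediateField _)
    (h.restrictTo_ne_one hχ hι) hν hw, quadSum]
  refine Fintype.sum_bijective Θ ⟨hΘ, Finite.surjective_of_injective hΘ⟩ _ _ fun b => ?_
  rw [AddChar.restrictTo_apply]
  congr 1
  simp only [Θ, ν, MulMemClass.coe_mul, SubmonoidClass.coe_pow]
  field_simp

/-- The character sum of a degenerate pair. -/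
lemma sum_char_pairForm (h : CommutingPair σ ι) (hχ : χ ≠ 1) (hι : ∀ x, χ (ι x) = χ x)
    (hσ : ∀ x, χ (σ x) = χ x) {x u : F} (hx : x ≠ 0) (hu : ι u = u) (hu0 : u ≠ 0) :
    ∑ z, χ (pairForm σ ι (alphaOf σ ι x u) (betaOf σ x u) z)
      = -Fintype.card (fixedSub ι) * ∑ l : commonFixed σ ι, χ (l ^ 2 / (2 * u)) := by
  have h2 := h.two_ne_zero
  obtain ⟨θ, hθ, hιθ⟩ := h.exists_anti
  let w : fixedSub ι := ⟨u / 2, by rw [mem_fixedSub, map_div₀, hu, map_ofNat]⟩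
  have hw : w ≠ 0 := by
    intro h0
    exact div_ne_zero hu0 h2 (congrArg Subtype.val h0)
  have hσs (y : F) : χ (σ.symm y) = χ y := by rw [← hσ, AlgEquiv.apply_symm_apply]
  have hpt (a b : fixedSub ι) : χ (pairForm σ ι (alphaOf σ ι x u) (betaOf σ x u) (x * (a + θ * b)))
      = χ (-(w * (σ a - a) ^ 2)) * χ (w * (θ * b + σ (θ * b)) ^ 2) := by
    have ha : ι (a : F) = a := a.2
    have hb : ι (b : F) = b := b.2
    obtain ⟨y, hy⟩ : ∃ y, y = θ * (b : F) := ⟨_, rfl⟩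
    have hιy : ι y = -y := by rw [hy, map_mul, hιθ, hb, neg_mul]
    rw [← hy, pairForm_mul hx, ← AddChar.map_add_eq_mul]
    have hsplit : -(u + σ.symm u) * ((a + y) * ι (a + y)) / 2 + u * ((a + y) * σ (a + y))
        = (-(w * (σ a - a) ^ 2) + w * (y + σ y) ^ 2)
          + (u / 2 * (σ (a ^ 2) - σ (y ^ 2)) + -(σ.symm (u / 2 * (σ (a ^ 2) - σ (y ^ 2)))))
          + u * (a * σ y + y * σ a) := by
      simp only [map_mul, map_add, map_sub, map_div₀, map_ofNat, AlgEquiv.symm_apply_apply, ha,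
        hιy, w, map_pow]
      field_simp
      ring
    have hanti : χ (u * (a * σ y + y * σ a)) = 1 := by
      apply h.char_eq_one_of_anti hι
      simp only [map_mul, map_add, h.comm, ha, hιy, hu, map_neg]
      ring
    have hinv (v : F) : χ (v + -(σ.symm v)) = 1 := by
      rw [AddChar.map_add_eq_mul, ← hσs v, ← AddChar.map_add_eq_mul, add_neg_cancel,
        AddChar.map_zero_eq_one]
    rw [hsplit, AddChar.map_add_eq_mul _ _ (u * _), hanti, mul_one, AddChar.map_add_eq_mul,
      hinv, mul_one]
  have h2E := h.two_ne_zero_of_intermediateField (fixedSub ι)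
  calc ∑ z, χ (pairForm σ ι (alphaOf σ ι x u) (betaOf σ x u) z)
      = ∑ z, χ (pairForm σ ι (alphaOf σ ι x u) (betaOf σ x u) (x * z)) :=
        (Fintype.sum_equiv (Equiv.mulLeft₀ x hx) _ _ fun _ => rfl).symm
    _ = (∑ a : fixedSub ι, χ (-(w * (σ a - a) ^ 2)))
          * ∑ b : fixedSub ι, χ (w * (θ * b + σ (θ * b)) ^ 2) := by
        rw [h.sum_eq_sum_sum hθ hιθ, Finset.sum_mul_sum]
        exact Finset.sum_congr rfl fun a _ => Finset.sum_congr rfl fun b _ => hpt a b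
    _ = _ := by
        rw [h.sum_char_invariant_part hχ hι hσ hw, h.sum_char_anti_part hχ hι hθ hιθ hw]
        have hq := quadSum_mul_quadSum_neg h2E (h.restrictTo_ne_one hχ hι) hw
        have h4 : (4 : F) * w = 2 * u := by simp only [w]; field_simp; norm_num
        rw [h4, ← hq]
        ring

end sums

end CommutingPair

namespace CommutingPair

variable {K F : Type*} [Field K] [Field F] [Algebra K F] {σ ι : F ≃ₐ[K] F}

/-- Number of zeros of the quadratic form attached to `(α, β)`. -/
def zeroCount [Fintype F] (σ ι : F ≃ₐ[K] F) (α β : F) : ℕ :=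
  (Finset.univ.filter fun x : F => Algebra.trace K F (pairForm σ ι α β x) = 0).card

/-- The condition on the parameter `u` making the kernel large. -/
def IsSpecial (σ ι : F ≃ₐ[K] F) (u : F) : Prop := ∃ a, ι a = a ∧ σ a - a = u⁻¹

/-- The additive character of `F` obtained from one of `K` through the trace. -/
def traceChar (F : Type*) [Field F] [Algebra K F] (ψ : AddChar K ℂ) : AddChar F ℂ :=
  ψ.compAddMonoidHom (Algebra.trace K F).toAddMonoidHom

lemma traceChar_apply (ψ : AddChar K ℂ) (x : F) : traceChar F ψ x = ψ (Algebra.trace K F x) := rfl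

lemma traceChar_map (ψ : AddChar K ℂ) (τ : F ≃ₐ[K] F) (x : F) :
    traceChar F ψ (τ x) = traceChar F ψ x := by
  rw [traceChar_apply, traceChar_apply, Algebra.trace_eq_of_algEquiv]

lemma traceChar_ne_one [Finite F] {ψ : AddChar K ℂ} (hψ : ψ ≠ 1) : traceChar F ψ ≠ 1 := by
  have : Finite K := Finite.of_injective _ (FaithfulSMul.algebraMap_injective K F)
  intro h
  apply hψ
  rw [AddChar.eq_one_iff] at h ⊢
  intro c
  obtain ⟨x, rfl⟩ := Algebra.trace_surjective K F c
  exact h x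

lemma alphaOf_smul (c : K) (x u : F) : alphaOf σ ι x (algebraMap K F c * u)
    = algebraMap K F c * alphaOf σ ι x u := by
  simp [alphaOf]; ring

lemma betaOf_smul (c : K) (x u : F) : betaOf σ x (algebraMap K F c * u)
    = algebraMap K F c * betaOf σ x u := by
  simp [betaOf]; ring

lemma pairForm_smul (c : K) (α β x : F) :
    pairForm σ ι (algebraMap K F c * α) (algebraMap K F c * β) x
      = algebraMap K F c * pairForm σ ι α β x := by
  simp [pairForm]; ring

section zeros

variable [Fintype K] [Fintype F]

lemma card_mul_zeroCount {ψ : AddChar K ℂ} (hψ : ψ ≠ 1) (α β : F) :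
    (Fintype.card K : ℂ) * zeroCount σ ι α β
      = Fintype.card F + ∑ c ∈ Finset.univ.filter (fun c : K => c ≠ 0),
          ∑ z, traceChar F ψ (algebraMap K F c * pairForm σ ι α β z) := by
  rw [zeroCount, card_mul_card_zeros hψ]
  congr 1
  refine Finset.sum_congr rfl fun c _ => Finset.sum_congr rfl fun z _ => ?_
  rw [traceChar_apply, ← Algebra.smul_def, map_smul, smul_eq_mul]

lemma card_mul_zeroCount_degenerate (h : CommutingPair σ ι) {ψ : AddChar K ℂ} (hψ : ψ ≠ 1)
    {x u : F} (hx : x ≠ 0) (hu : ι u = u) (hu0 : u ≠ 0) :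
    (Fintype.card K : ℂ) * zeroCount σ ι (alphaOf σ ι x u) (betaOf σ x u)
      = Fintype.card F - Fintype.card (fixedSub ι) *
        ∑ c ∈ Finset.univ.filter (fun c : K => c ≠ 0),
          ∑ l : commonFixed σ ι, traceChar F ψ (l ^ 2 / (2 * (algebraMap K F c * u))) := by
  rw [card_mul_zeroCount hψ, Finset.mul_sum, sub_eq_add_neg, ← Finset.sum_neg_distrib]
  congr 1
  refine Finset.sum_congr rfl fun c hc => ?_
  have hc0 : algebraMap K F c ≠ 0 := by simpa using (Finset.mem_filter.mp hc).2
  rw [← neg_mul, ← h.sum_char_pairForm (traceChar_ne_one hψ) (traceChar_map ψ ι) (traceChar_map ψ σ)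
    hx (by rw [map_mul, hu, AlgEquiv.commutes]) (mul_ne_zero hc0 hu0)]
  refine Finset.sum_congr rfl fun z _ => ?_
  rw [alphaOf_smul, betaOf_smul, pairForm_smul]

omit [Fintype F] in
lemma card_filter_ne_zero :
    (((Finset.univ.filter fun c : K => c ≠ 0).card : ℕ) : ℤ) = Fintype.card K - 1 := by
  have : (Finset.univ.filter fun c : K => c ≠ 0) = Finset.univ.erase 0 := by ext; simp
  rw [this, Finset.card_erase_of_mem (Finset.mem_univ _), Finset.card_univ,
    Nat.cast_sub Fintype.card_pos]
  simp

lemma zeroCount_of_isSpecial (h : CommutingPair σ ι) {ψ : AddChar K ℂ} (hψ : ψ ≠ 1)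
    {x u : F} (hx : x ≠ 0) (hu : ι u = u) (hu0 : u ≠ 0) (hs : IsSpecial σ ι u) :
    (Fintype.card K : ℤ) * zeroCount σ ι (alphaOf σ ι x u) (betaOf σ x u)
      = Fintype.card F + (Fintype.card K - 1) *
        -(Fintype.card (fixedSub ι) * Fintype.card (commonFixed σ ι)) := by
  have h2 := h.two_ne_zero
  obtain ⟨a, ha, hau⟩ := hs
  have h1 := h.card_mul_zeroCount_degenerate hψ hx hu hu0
  have hone : ∀ c ∈ Finset.univ.filter (fun c : K => c ≠ 0), ∀ l : commonFixed σ ι,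
      traceChar F ψ (l ^ 2 / (2 * (algebraMap K F c * u))) = 1 := by
    intro c hc l
    have hc0 : algebraMap K F c ≠ 0 := by simpa using (Finset.mem_filter.mp hc).2
    have hl : σ (l : F) = l := l.2.1
    have : (l : F) ^ 2 / (2 * (algebraMap K F c * u))
        = σ (l ^ 2 / (2 * algebraMap K F c) * a) + -(l ^ 2 / (2 * algebraMap K F c) * a) := by
      simp only [map_mul, map_div₀, map_pow, hl, map_ofNat, AlgEquiv.commutes]
      have : σ a = u⁻¹ + a := by rw [← hau]; ring
      rw [this]; field_simp; ring
    rw [this, AddChar.map_add_eq_mul, traceChar_map, ← AddChar.map_add_eq_mul]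
    simp
  rw [Finset.sum_congr rfl fun c hc => Finset.sum_congr rfl fun l _ => hone c hc l] at h1
  simp only [Finset.sum_const, Finset.card_univ, nsmul_eq_mul, mul_one] at h1
  rw [← card_filter_ne_zero]
  have h3 : (Fintype.card K : ℂ) * zeroCount σ ι (alphaOf σ ι x u) (betaOf σ x u)
      = Fintype.card F + (Finset.univ.filter fun c : K => c ≠ 0).card *
        -(Fintype.card (fixedSub ι) * Fintype.card (commonFixed σ ι)) := by
    rw [h1]; ring
  exact_mod_cast h3

lemma zeroCount_of_not_isSpecial (h : CommutingPair σ ι) {ψ : AddChar K ℂ} (hψ : ψ ≠ 1)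
    {ν : K} (hν : ¬ IsSquare (algebraMap K (commonFixed σ ι) ν))
    {x u : F} (hx : x ≠ 0) (hu : ι u = u) (hu0 : u ≠ 0) (hs : ¬ IsSpecial σ ι u) :
    (Fintype.card K : ℤ) * zeroCount σ ι (alphaOf σ ι x u) (betaOf σ x u) = Fintype.card F := by
  have h2 := h.two_ne_zero
  have h1 := h.card_mul_zeroCount_degenerate hψ hx hu hu0
  have hν0 : ν ≠ 0 := by rintro rfl; exact hν (by simp)
  set s : K → ℂ := fun c =>
    ∑ l : commonFixed σ ι, traceChar F ψ (l ^ 2 / (2 * (algebraMap K F c * u))) with hsdef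
  have hneg (c : K) (hc : c ≠ 0) : s (ν⁻¹ * c) = -s c := by
    have hc0 : algebraMap K F c ≠ 0 := by simpa using hc
    have hν0' : algebraMap K F ν ≠ 0 := by simpa using hν0
    have h3 := sum_comp_sq_add_sum_comp_nonsquare_mul_sq
      (h.two_ne_zero_of_intermediateField (commonFixed σ ι)) hν
      fun l => traceChar F ψ (l * (2 * (algebraMap K F c * u))⁻¹)
    let c' : fixedSub ι := ⟨(2 * (algebraMap K F c * u))⁻¹, by
      simp [hu, map_ofNat]⟩
    have h4 := h.sum_char_eq_card_fiber (traceChar_ne_one hψ) (traceChar_map ψ ι)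
      (traceChar_map ψ σ) c'
    rw [show (∑ l : commonFixed σ ι, traceChar F ψ (l * (2 * (algebraMap K F c * u))⁻¹)) = 0 by
      rw [h4, Nat.cast_eq_zero, Finset.card_eq_zero, Finset.filter_eq_empty_iff]
      intro a _ ha
      refine hs ⟨2 * algebraMap K F c * a, by
        rw [map_mul, map_mul, map_ofNat, AlgEquiv.commutes, a.2], ?_⟩
      simp only [map_mul, map_ofNat, AlgEquiv.commutes]
      rw [← mul_sub, ha]
      simp only [c']; field_simp, mul_zero] at h3
    rw [eq_neg_iff_add_eq_zero, ← h3, add_comm]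
    have hcoe : ((algebraMap K (commonFixed σ ι) ν : commonFixed σ ι) : F) = algebraMap K F ν := rfl
    congr 1 <;> refine Finset.sum_congr rfl fun l _ => ?_
    · rw [SubmonoidClass.coe_pow, div_eq_mul_inv]
    · rw [MulMemClass.coe_mul, SubmonoidClass.coe_pow, hcoe, map_mul, map_inv₀]
      congr 1
      field_simp
  have hzero : ∑ c ∈ Finset.univ.filter (fun c : K => c ≠ 0), s c = 0 := by
    have h3 : ∑ c ∈ Finset.univ.filter (fun c : K => c ≠ 0), s (ν⁻¹ * c)
        = ∑ c ∈ Finset.univ.filter (fun c : K => c ≠ 0), s c :=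
      Finset.sum_equiv (Equiv.mulLeft₀ ν⁻¹ (inv_ne_zero hν0)) (by simp [hν0]) fun _ _ => rfl
    rw [Finset.sum_congr rfl fun c hc => hneg c (Finset.mem_filter.mp hc).2,
      Finset.sum_neg_distrib] at h3
    linear_combination -h3 / 2
  rw [hzero, mul_zero, sub_zero] at h1
  exact_mod_cast h1

omit [Fintype K] [Fintype F] in
/-- The quadratic form attached to `(α, β)`. -/
lemma exists_quadraticForm (h : CommutingPair σ ι) {α : F} (β : F) (hα : ι α = α) :
    ∃ Q : QuadraticForm K F, (∀ x, Q x = Algebra.trace K F (pairForm σ ι α β x)) ∧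
      ∀ x y, QuadraticMap.polar Q x y = Algebra.trace K F (pairLin σ ι α β x * y) := by
  have h2 := h.two_ne_zero
  have hpolar (x y : F) :
      QuadraticMap.polar (fun x => Algebra.trace K F (pairForm σ ι α β x)) x y
        = Algebra.trace K F (pairLin σ ι α β x * y) := by
    have h1 : pairForm σ ι α β (x + y) - pairForm σ ι α β x - pairForm σ ι α β y
        = pairLin σ ι α β x * y + (ι (α * ι x * y / 2) - α * ι x * y / 2)
          + (σ (σ.symm (β * x) * y) - σ.symm (β * x) * y) := by
      simp only [pairForm, pairLin, map_add, map_mul, map_div₀, map_ofNat, h.invol, hα,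
        AlgEquiv.apply_symm_apply]
      field_simp
      ring
    rw [QuadraticMap.polar, ← map_sub, ← map_sub, h1, map_add, map_add, map_sub, map_sub,
      Algebra.trace_eq_of_algEquiv, Algebra.trace_eq_of_algEquiv]
    ring
  have hlin_add (x y : F) : pairLin σ ι α β (x + y) = pairLin σ ι α β x + pairLin σ ι α β y := by
    simp [pairLin, mul_add]; ring
  have hlin_smul (c : K) (x : F) : pairLin σ ι α β (c • x) = c • pairLin σ ι α β x := by
    simp only [pairLin, Algebra.smul_def, map_mul, AlgEquiv.commutes]; ring
  refine ⟨QuadraticMap.ofPolar (fun x => Algebra.trace K F (pairForm σ ι α β x)) ?_ ?_ ?_,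
    fun _ => rfl, hpolar⟩
  · intro c x
    rw [← map_smul]
    congr 1
    simp only [pairForm, Algebra.smul_def, map_mul, AlgEquiv.commutes]; ring
  · intro x y z
    rw [hpolar, hpolar, hpolar, hlin_add, add_mul, map_add]
  · intro c x y
    rw [hpolar, hpolar, hlin_smul, smul_mul_assoc, map_smul]

omit [Fintype K] in
lemma card_eq_sq (h : CommutingPair σ ι) :
    Fintype.card F = Fintype.card (fixedSub ι) ^ 2 := by
  obtain ⟨θ, hθ, hιθ⟩ := h.exists_anti
  have := h.sum_eq_sum_sum hθ hιθ fun _ => 1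
  simp only [Finset.sum_const, Finset.card_univ, nsmul_eq_mul, mul_one] at this
  rw [sq]; exact_mod_cast this

lemma zeroCount_of_nondegenerate (h : CommutingPair σ ι) {ψ : AddChar K ℂ} (hψ : ψ ≠ 1)
    {α β : F} (hα : ι α = α) (hker : ∀ x, pairLin σ ι α β x = 0 → x = 0) :
    ∃ ε : ℤ, (ε = 1 ∨ ε = -1) ∧ (Fintype.card K : ℤ) * zeroCount σ ι α β
      = Fintype.card F + (Fintype.card K - 1) * (ε * Fintype.card (fixedSub ι)) := by
  obtain ⟨Q, hQ, hpol⟩ := h.exists_quadraticForm β hα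
  have hE : Fintype.card (fixedSub ι) = Fintype.card K ^ Module.finrank K (fixedSub ι) :=
    Module.card_eq_pow_finrank
  have hrank : Module.finrank K F = 2 * Module.finrank K (fixedSub ι) := by
    apply Nat.pow_right_injective (Fintype.one_lt_card (α := K))
    simp only
    rw [← Module.card_eq_pow_finrank (V := F), h.card_eq_sq, hE]
    ring
  have h2K : (2 : K) ≠ 0 := by
    intro h0
    have := congrArg (algebraMap K F) h0
    rw [map_ofNat, map_zero] at this
    exact h.two_ne_zero this
  obtain ⟨ε, hε, hsum⟩ := exists_sum_char_quadraticForm h2K hψ Q (by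
    intro x hx
    apply hker
    refine (traceForm_nondegenerate K F).1 _ fun y => ?_
    rw [Algebra.traceForm_apply, ← hpol]
    exact hx y) hrank
  refine ⟨ε, hε, ?_⟩
  have h1 := card_mul_card_zeros hψ (fun x => Algebra.trace K F (pairForm σ ι α β x))
  simp only [← hQ] at h1
  rw [Finset.sum_congr rfl fun c hc => hsum c (Finset.mem_filter.mp hc).2, Finset.sum_const,
    nsmul_eq_mul] at h1
  rw [← card_filter_ne_zero, zeroCount, hE]
  simp only [← hQ]
  exact_mod_cast h1

end zeros

end CommutingPair

namespace CommutingPair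

variable {K F : Type*} [Field K] [Field F] [Algebra K F] {σ ι : F ≃ₐ[K] F} [Fintype F]

lemma card_filter_fixed : (Finset.univ.filter fun z : F => ι z = z).card
    = Fintype.card (fixedSub ι) := (Fintype.card_subtype _).symm

lemma card_filter_commonFixed : (Finset.univ.filter fun z : F => ι z = z ∧ σ z = z).card
    = Fintype.card (commonFixed σ ι) := by
  rw [← Fintype.card_subtype]
  exact Fintype.card_congr (Equiv.subtypeEquivRight fun z => and_comm)

lemma card_filter_sub_eq {c a : F} (ha : ι a = a) (hac : σ a - a = c) :
    (Finset.univ.filter fun z : F => ι z = z ∧ σ z - z = c).card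
      = Fintype.card (commonFixed σ ι) := by
  rw [← card_filter_commonFixed]
  refine Finset.card_equiv (Equiv.subRight a) fun z => ?_
  simp only [Finset.mem_filter, Finset.mem_univ, true_and, Equiv.subRight_apply, map_sub, ha,
    sub_left_inj]
  refine and_congr_right fun _ => ⟨fun hz => ?_, fun hz => ?_⟩
  · linear_combination hz - hac
  · linear_combination hz + hac

lemma card_kernel_of_isSpecial (h : CommutingPair σ ι) {x u : F} (hx : x ≠ 0) (hu : ι u = u)
    (hu0 : u ≠ 0) (hs : IsSpecial σ ι u) :
    (Finset.univ.filter fun y => pairLin σ ι (alphaOf σ ι x u) (betaOf σ x u) y = 0).card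
      = Fintype.card (commonFixed σ ι) ^ 2 := by
  obtain ⟨a, ha, hau⟩ := hs
  have h1 : (Finset.univ.filter fun y =>
        pairLin σ ι (alphaOf σ ι x u) (betaOf σ x u) y = 0).card
      = (Finset.univ.filter fun z => ι z = z ∧ σ (u * (σ z - z)) = u * (σ z - z)).card :=
    (Finset.card_equiv (Equiv.mulLeft₀ x hx) fun z => by
      simp [h.pairLin_eq_zero_iff hx hu hu0]).symm
  rw [h1, Finset.card_eq_sum_card_fiberwise (f := fun z => u * (σ z - z))
    (t := Finset.univ.filter fun l => ι l = l ∧ σ l = l) (by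
      intro z hz
      simp only [Finset.coe_filter, Finset.mem_univ, true_and, Set.mem_ofPred_eq] at hz ⊢
      exact ⟨by rw [map_mul, map_sub, h.comm, hz.1, hu], hz.2⟩)]
  rw [Finset.sum_const_nat (m := Fintype.card (commonFixed σ ι)), card_filter_commonFixed, sq]
  intro l hl
  obtain ⟨hl1, hl2⟩ := (Finset.mem_filter.mp hl).2
  rw [← card_filter_sub_eq (a := l * a) (c := l * u⁻¹) (by rw [map_mul, hl1, ha])
    (by rw [map_mul, hl2, ← hau]; ring), Finset.filter_filter]
  congr 1
  ext z
  simp only [Finset.mem_filter, Finset.mem_univ, true_and]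
  constructor
  · rintro ⟨⟨hz, -⟩, h2⟩
    exact ⟨hz, by rw [← h2]; field_simp⟩
  · rintro ⟨hz, h2⟩
    have h3 : u * (σ z - z) = l := by rw [h2]; field_simp
    exact ⟨⟨hz, by rw [h3, hl2]⟩, h3⟩

lemma card_kernel_of_not_isSpecial (h : CommutingPair σ ι) {x u : F} (hx : x ≠ 0) (hu : ι u = u)
    (hu0 : u ≠ 0) (hs : ¬ IsSpecial σ ι u) :
    (Finset.univ.filter fun y => pairLin σ ι (alphaOf σ ι x u) (betaOf σ x u) y = 0).card
      = Fintype.card (commonFixed σ ι) := by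
  rw [← card_filter_commonFixed]
  refine (Finset.card_equiv (Equiv.mulLeft₀ x hx) fun z => ?_).symm
  simp only [Finset.mem_filter, Finset.mem_univ, true_and, Equiv.mulLeft₀_apply,
    h.pairLin_eq_zero_iff hx hu hu0]
  refine and_congr_right fun hz => ⟨fun h1 => by simp [h1], fun h1 => ?_⟩
  by_contra h2
  have h3 : σ z - z ≠ 0 := sub_ne_zero.mpr h2
  have hl0 : u * (σ z - z) ≠ 0 := mul_ne_zero hu0 h3
  refine hs ⟨z / (u * (σ z - z)), ?_, ?_⟩
  · rw [map_div₀, hz, map_mul, map_sub, h.comm, hz, hu]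
  · rw [map_div₀, h1]
    field_simp

lemma one_lt_card_commonFixed : 1 < Fintype.card (commonFixed σ ι) := Fintype.one_lt_card

/-- The degenerate parameters `(x, u)` with `u` satisfying `P`. -/
def params (ι : F ≃ₐ[K] F) (P : F → Prop) : Finset (F × F) :=
  (Finset.univ.filter fun x : F => x ≠ 0) ×ˢ (Finset.univ.filter fun u : F => ι u = u ∧ u ≠ 0 ∧ P u)

/-- The pair `(α, β)` with parameters `(x, u)`. -/
def pairOf (σ ι : F ≃ₐ[K] F) (xu : F × F) : F × F := (alphaOf σ ι xu.1 xu.2, betaOf σ xu.1 xu.2)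

lemma mem_params {P : F → Prop} {x u : F} :
    (x, u) ∈ params ι P ↔ x ≠ 0 ∧ ι u = u ∧ u ≠ 0 ∧ P u := by
  simp [params]

lemma card_params (P : F → Prop) [DecidablePred P] :
    (params ι P).card = (Finset.univ.filter fun x : F => x ≠ 0).card
      * (Finset.univ.filter fun u => ι u = u ∧ u ≠ 0 ∧ P u).card := by
  rw [params, Finset.card_product]
  congr!

/-- If all kernels over parameters satisfying `P` have `N` elements, and `P` depends only on the
pair, then the fibres of `pairOf` have `N - 1` elements. -/
lemma card_image_pairOf (h : CommutingPair σ ι) {P : F → Prop} {N : ℕ}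
    (hP : ∀ x u y v, x ≠ 0 → ι u = u → u ≠ 0 → y ≠ 0 → ι v = v → v ≠ 0 →
      pairOf σ ι (x, u) = pairOf σ ι (y, v) → P u → P v)
    (hN : ∀ x u, x ≠ 0 → ι u = u → u ≠ 0 → P u →
      (Finset.univ.filter fun y =>
        pairLin σ ι (alphaOf σ ι x u) (betaOf σ x u) y = 0).card = N) :
    ((params ι P).image (pairOf σ ι)).card * (N - 1) = (params ι P).card := by
  rw [Finset.card_eq_sum_card_image (pairOf σ ι) (params ι P),
    Finset.sum_const_nat (m := N - 1)]
  intro b hb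
  obtain ⟨⟨x, u⟩, hxu, rfl⟩ := Finset.mem_image.mp hb
  obtain ⟨hx, hu, hu0, hPu⟩ := mem_params.mp hxu
  have hα := h.map_alphaOf (x := x) hu
  set α := alphaOf σ ι x u with hαdef
  set β := betaOf σ x u with hβdef
  have hβ0 : β ≠ 0 := by
    rw [hβdef, betaOf]
    exact div_ne_zero hu0 (mul_ne_zero hx (by simpa using hx))
  rw [← hN x u hx hu hu0 hPu, ← Finset.card_erase_of_mem (a := 0) (by simp [pairLin])]
  refine Finset.card_nbij' Prod.fst (fun y => (y, β * (y * σ y))) ?_ ?_ ?_ ?_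
  · rintro ⟨y, v⟩ hyv
    obtain ⟨hyv, heq⟩ := Finset.mem_filter.mp hyv
    obtain ⟨hy, hv, hv0, hPv⟩ := mem_params.mp hyv
    have h1 : alphaOf σ ι y v = α := congrArg Prod.fst heq
    have h2 : betaOf σ y v = β := congrArg Prod.snd heq
    have h3 := (h.pairLin_eq_zero_iff hy hv hv0 1).mpr (by simp)
    rw [h1, h2, mul_one] at h3
    simp only [Finset.coe_erase, Finset.coe_filter, Finset.mem_univ, true_and, Set.mem_sdiff,
      Set.mem_ofPred_eq, Set.mem_singleton_iff]
    exact ⟨h3, hy⟩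
  · intro y hy
    simp only [Finset.coe_erase, Finset.coe_filter, Finset.mem_univ, true_and, Set.mem_sdiff,
      Set.mem_ofPred_eq, Set.mem_singleton_iff] at hy
    obtain ⟨hv, h1, h2⟩ := h.eq_alphaOf_betaOf hα hy.2 hy.1
    have hv0 : β * (y * σ y) ≠ 0 := mul_ne_zero hβ0 (mul_ne_zero hy.2 (by simpa using hy.2))
    have heq : pairOf σ ι (y, β * (y * σ y)) = pairOf σ ι (x, u) := (Prod.ext h1 h2).symm
    simp only [Finset.coe_filter, Set.mem_ofPred_eq]
    exact ⟨mem_params.mpr ⟨hy.2, hv, hv0, hP x u _ _ hx hu hu0 hy.2 hv hv0 heq.symm hPu⟩, heq⟩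
  · rintro ⟨y, v⟩ hyv
    simp only [Finset.coe_filter, Set.mem_ofPred_eq] at hyv
    obtain ⟨hyv, heq⟩ := hyv
    obtain ⟨hy, hv, hv0, hPv⟩ := mem_params.mp hyv
    have h2 : betaOf σ y v = β := congrArg Prod.snd heq
    have hσy : σ y ≠ 0 := by simpa using hy
    simp only [Prod.mk.injEq, true_and, ← h2, betaOf]
    field_simp
  · intro y _
    rfl

lemma isSpecial_iff_of_pairOf_eq (h : CommutingPair σ ι) {x u y v : F} (hx : x ≠ 0)
    (hu : ι u = u) (hu0 : u ≠ 0) (hy : y ≠ 0) (hv : ι v = v) (hv0 : v ≠ 0)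
    (heq : pairOf σ ι (x, u) = pairOf σ ι (y, v)) : IsSpecial σ ι u ↔ IsSpecial σ ι v := by
  have h1 : alphaOf σ ι x u = alphaOf σ ι y v := congrArg Prod.fst heq
  have h2 : betaOf σ x u = betaOf σ y v := congrArg Prod.snd heq
  have hl := one_lt_card_commonFixed (σ := σ) (ι := ι)
  by_cases hsu : IsSpecial σ ι u <;> by_cases hsv : IsSpecial σ ι v <;> simp only [hsu, hsv] <;>
    exfalso
  · have h3 := h.card_kernel_of_isSpecial hx hu hu0 hsu
    rw [h1, h2, h.card_kernel_of_not_isSpecial hy hv hv0 hsv] at h3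
    nlinarith
  · have h3 := h.card_kernel_of_not_isSpecial hx hu hu0 hsu
    rw [h1, h2, h.card_kernel_of_isSpecial hy hv hv0 hsv] at h3
    nlinarith

lemma card_isSpecial (h : CommutingPair σ ι) :
    (Finset.univ.filter fun u => ι u = u ∧ u ≠ 0 ∧ IsSpecial σ ι u).card
        * Fintype.card (commonFixed σ ι) + Fintype.card (commonFixed σ ι)
      = Fintype.card (fixedSub ι) := by
  rw [← card_filter_fixed (ι := ι), ← Finset.card_filter_add_card_filter_not (fun z => σ z ≠ z)
    (s := Finset.univ.filter fun z => ι z = z)]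
  congr 1
  · rw [Finset.card_eq_sum_card_fiberwise 
      (s := (Finset.univ.filter fun z => ι z = z).filter fun z => σ z ≠ z)
      (f := fun z => (σ z - z)⁻¹)
      (t := Finset.univ.filter fun u => ι u = u ∧ u ≠ 0 ∧ IsSpecial σ ι u) ?_,
      Finset.sum_const_nat (m := Fintype.card (commonFixed σ ι))]
    · rintro u hu
      obtain ⟨hu, hu0, a, ha, hau⟩ := (Finset.mem_filter.mp hu).2
      rw [← card_filter_sub_eq ha hau, Finset.filter_filter, Finset.filter_filter]
      congr 1
      ext z
      simp only [Finset.mem_filter, Finset.mem_univ, true_and]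
      constructor
      · rintro ⟨hz, -, h1⟩
        exact ⟨hz, by rw [← h1, inv_inv]⟩
      · rintro ⟨hz, h1⟩
        refine ⟨hz, fun h0 => inv_ne_zero hu0 ?_, by rw [h1, inv_inv]⟩
        rw [← h1, h0, sub_self]
    · intro z hz
      simp only [Finset.coe_filter, Finset.mem_univ, true_and, Finset.mem_filter,
        Set.mem_ofPred_eq] at hz ⊢
      exact ⟨by rw [map_inv₀, map_sub, h.comm, hz.1], inv_ne_zero (sub_ne_zero.mpr hz.2), z, hz.1,
        (inv_inv _).symm⟩
  · rw [← card_filter_commonFixed, Finset.filter_filter]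
    simp

omit [Algebra K F] in
lemma card_ne_zero_add_one : (Finset.univ.filter fun x : F => x ≠ 0).card + 1 = Fintype.card F := by
  rw [Finset.filter_ne', Finset.card_erase_add_one (Finset.mem_univ _), Finset.card_univ]

lemma card_isSpecial_add_card_not_isSpecial :
    (Finset.univ.filter fun u => ι u = u ∧ u ≠ 0 ∧ IsSpecial σ ι u).card
      + (Finset.univ.filter fun u => ι u = u ∧ u ≠ 0 ∧ ¬ IsSpecial σ ι u).card + 1
      = Fintype.card (fixedSub ι) := by
  have h1 : (Finset.univ.filter fun u => ι u = u ∧ u ≠ 0)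
      = (Finset.univ.filter fun u => ι u = u).erase 0 := by
    ext u; simp [and_comm]
  have h2 : (Finset.univ.filter fun u => ι u = u ∧ u ≠ 0).card + 1
      = Fintype.card (fixedSub ι) := by
    rw [h1, Finset.card_erase_add_one (by simp), card_filter_fixed]
  rw [← h2, ← Finset.card_filter_add_card_filter_not (IsSpecial σ ι)
    (s := Finset.univ.filter fun u => ι u = u ∧ u ≠ 0), Finset.filter_filter, Finset.filter_filter]
  simp only [and_assoc]

lemma card_image_isSpecial (h : CommutingPair σ ι) :
    (((params ι (IsSpecial σ ι)).image (pairOf σ ι)).card : ℤ)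
        * (Fintype.card (commonFixed σ ι) ^ 2 - 1) * Fintype.card (commonFixed σ ι)
      = (Fintype.card (fixedSub ι) ^ 2 - 1)
        * (Fintype.card (fixedSub ι) - Fintype.card (commonFixed σ ι)) := by
  have h1 := h.card_image_pairOf (P := IsSpecial σ ι)
    (fun x u y v hx hu hu0 hy hv hv0 heq =>
      (h.isSpecial_iff_of_pairOf_eq hx hu hu0 hy hv hv0 heq).mp)
    (fun x u hx hu hu0 hs => h.card_kernel_of_isSpecial hx hu hu0 hs)
  have h2 := h.card_isSpecial
  have h3 := card_ne_zero_add_one (F := F)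
  rw [h.card_eq_sq] at h3
  rw [card_params] at h1
  have hl := one_lt_card_commonFixed (σ := σ) (ι := ι)
  zify [Nat.one_le_pow 2 _ (zero_lt_one.trans hl)] at h1 h2 h3
  rw [h1, ← h3]
  linear_combination ((Finset.univ.filter fun x : F => x ≠ 0).card : ℤ) * h2

lemma card_image_not_isSpecial (h : CommutingPair σ ι) :
    (((params ι (fun u => ¬ IsSpecial σ ι u)).image (pairOf σ ι)).card : ℤ)
        * Fintype.card (commonFixed σ ι)
      = (Fintype.card (fixedSub ι) ^ 2 - 1) * Fintype.card (fixedSub ι) := by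
  have h1 := h.card_image_pairOf (P := fun u => ¬ IsSpecial σ ι u)
    (fun x u y v hx hu hu0 hy hv hv0 heq =>
      (not_congr (h.isSpecial_iff_of_pairOf_eq hx hu hu0 hy hv hv0 heq)).mp)
    (fun x u hx hu hu0 hs => h.card_kernel_of_not_isSpecial hx hu hu0 hs)
  have h2 := h.card_isSpecial
  have h3 := card_ne_zero_add_one (F := F)
  have h4 := card_isSpecial_add_card_not_isSpecial (σ := σ) (ι := ι)
  rw [h.card_eq_sq] at h3
  rw [card_params] at h1
  have hl := one_lt_card_commonFixed (σ := σ) (ι := ι)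
  zify [hl.le] at h1 h2 h3 h4
  have hl' : (1 : ℤ) < Fintype.card (commonFixed σ ι) := by exact_mod_cast hl
  apply mul_right_cancel₀ (sub_pos.mpr hl').ne'
  rw [← h3]
  linear_combination (Fintype.card (commonFixed σ ι) : ℤ) * h1 +
    ((Finset.univ.filter fun x : F => x ≠ 0).card : ℤ) *
      ((Fintype.card (commonFixed σ ι) : ℤ) * h4 - h2)

end CommutingPair

namespace CommutingPair

variable {K F : Type*} [Field K] [Field F] [Algebra K F] {σ ι : F ≃ₐ[K] F}
  [Fintype K] [Fintype F]

/-- The pairs `(α, β)` whose number of zeros deviates from the average `|F| / |K|` by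
`(1 - 1 / |K|) τ`. -/
def pairsWith (σ ι : F ≃ₐ[K] F) (τ : ℤ) : Finset (F × F) :=
  Finset.univ.filter fun ab => ι ab.1 = ab.1 ∧
    (Fintype.card K : ℤ) * zeroCount σ ι ab.1 ab.2 = Fintype.card F + (Fintype.card K - 1) * τ

lemma mem_pairsWith {τ : ℤ} {ab : F × F} : ab ∈ pairsWith σ ι τ ↔ ι ab.1 = ab.1 ∧
    (Fintype.card K : ℤ) * zeroCount σ ι ab.1 ab.2
      = Fintype.card F + (Fintype.card K - 1) * τ := by
  simp [pairsWith]

lemma eq_of_mem_pairsWith {τ τ' : ℤ} {ab : F × F} (h1 : ab ∈ pairsWith σ ι τ)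
    (h2 : ab ∈ pairsWith σ ι τ') : τ = τ' := by
  have hK : (1 : ℤ) < Fintype.card K := by exact_mod_cast Fintype.one_lt_card
  apply mul_left_cancel₀ (sub_pos.mpr hK).ne'
  linear_combination (mem_pairsWith.mp h2).2 - (mem_pairsWith.mp h1).2

lemma zero_mem_pairsWith : (0, 0) ∈ pairsWith σ ι (Fintype.card F) := by
  rw [mem_pairsWith]
  refine ⟨map_zero _, ?_⟩
  have : zeroCount σ ι 0 0 = Fintype.card F := by simp [zeroCount, pairForm]
  rw [this]
  ring

lemma mem_pairsWith_of_isSpecial (h : CommutingPair σ ι) {ψ : AddChar K ℂ} (hψ : ψ ≠ 1)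
    {ab : F × F} (hab : ab ∈ (params ι (IsSpecial σ ι)).image (pairOf σ ι)) :
    ab ∈ pairsWith σ ι (-(Fintype.card (fixedSub ι) * Fintype.card (commonFixed σ ι))) := by
  obtain ⟨⟨x, u⟩, hxu, rfl⟩ := Finset.mem_image.mp hab
  obtain ⟨hx, hu, hu0, hs⟩ := mem_params.mp hxu
  exact mem_pairsWith.mpr ⟨h.map_alphaOf hu, h.zeroCount_of_isSpecial hψ hx hu hu0 hs⟩

lemma mem_pairsWith_of_not_isSpecial (h : CommutingPair σ ι) {ψ : AddChar K ℂ} (hψ : ψ ≠ 1)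
    {ν : K} (hν : ¬ IsSquare (algebraMap K (commonFixed σ ι) ν))
    {ab : F × F} (hab : ab ∈ (params ι fun u => ¬ IsSpecial σ ι u).image (pairOf σ ι)) :
    ab ∈ pairsWith σ ι 0 := by
  obtain ⟨⟨x, u⟩, hxu, rfl⟩ := Finset.mem_image.mp hab
  obtain ⟨hx, hu, hu0, hs⟩ := mem_params.mp hxu
  refine mem_pairsWith.mpr ⟨h.map_alphaOf hu, ?_⟩
  rw [mul_zero, add_zero]
  exact h.zeroCount_of_not_isSpecial hψ hν hx hu hu0 hs

/-- Classification of the pairs. -/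
lemma pair_cases (h : CommutingPair σ ι) {ψ : AddChar K ℂ} (hψ : ψ ≠ 1) {ab : F × F}
    (hα : ι ab.1 = ab.1) :
    ab = (0, 0) ∨ ab ∈ (params ι (IsSpecial σ ι)).image (pairOf σ ι) ∨
      ab ∈ (params ι fun u => ¬ IsSpecial σ ι u).image (pairOf σ ι) ∨
      ab ∈ pairsWith σ ι (Fintype.card (fixedSub ι)) ∨
      ab ∈ pairsWith σ ι (-Fintype.card (fixedSub ι)) := by
  by_cases hker : ∀ x, pairLin σ ι ab.1 ab.2 x = 0 → x = 0
  · right; right; right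
    obtain ⟨ε, rfl | rfl, hε⟩ := h.zeroCount_of_nondegenerate hψ hα hker
    · left; exact mem_pairsWith.mpr ⟨hα, by rw [hε, one_mul]⟩
    · right; exact mem_pairsWith.mpr ⟨hα, by rw [hε, neg_one_mul]⟩
  · push Not at hker
    obtain ⟨x, hx, hx0⟩ := hker
    obtain ⟨hu, h1, h2⟩ := h.eq_alphaOf_betaOf hα hx0 hx
    set u := ab.2 * (x * σ x) with hudef
    by_cases hu0 : u = 0
    · left
      rw [hu0] at h1 h2
      exact Prod.ext (by simpa [alphaOf] using h1) (by simpa [betaOf] using h2)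
    · right
      have heq : pairOf σ ι (x, u) = ab := (Prod.ext h1 h2).symm
      by_cases hs : IsSpecial σ ι u
      · left; exact Finset.mem_image.mpr ⟨(x, u), mem_params.mpr ⟨hx0, hu, hu0, hs⟩, heq⟩
      · right; left
        exact Finset.mem_image.mpr ⟨(x, u), mem_params.mpr ⟨hx0, hu, hu0, hs⟩, heq⟩

/-- All possible deviations. -/
lemma mem_pairsWith_cases (h : CommutingPair σ ι) {ψ : AddChar K ℂ} (hψ : ψ ≠ 1)
    {ν : K} (hν : ¬ IsSquare (algebraMap K (commonFixed σ ι) ν)) {ab : F × F}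
    (hα : ι ab.1 = ab.1) :
    ab ∈ pairsWith σ ι (Fintype.card (fixedSub ι)) ∨ ab ∈ pairsWith σ ι 0 ∨
      ab ∈ pairsWith σ ι (-Fintype.card (fixedSub ι)) ∨
      ab ∈ pairsWith σ ι (-(Fintype.card (fixedSub ι) * Fintype.card (commonFixed σ ι))) ∨
      ab ∈ pairsWith σ ι (Fintype.card F) := by
  rcases h.pair_cases hψ hα with rfl | h1 | h1 | h1 | h1
  · have := zero_mem_pairsWith (σ := σ) (ι := ι); tauto
  · have := h.mem_pairsWith_of_isSpecial hψ h1; tauto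
  · have := h.mem_pairsWith_of_not_isSpecial hψ hν h1; tauto
  · tauto
  · tauto

omit [Fintype K] in
lemma card_bounds (h : CommutingPair σ ι) :
    (1 : ℤ) < Fintype.card (fixedSub ι) ∧ (1 : ℤ) < Fintype.card (commonFixed σ ι) ∧
      (Fintype.card F : ℤ) = Fintype.card (fixedSub ι) ^ 2 :=
  ⟨by exact_mod_cast Fintype.one_lt_card, by exact_mod_cast Fintype.one_lt_card,
    by exact_mod_cast h.card_eq_sq⟩

lemma pairsWith_neg_mul (h : CommutingPair σ ι) {ψ : AddChar K ℂ} (hψ : ψ ≠ 1)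
    {ν : K} (hν : ¬ IsSquare (algebraMap K (commonFixed σ ι) ν)) :
    pairsWith σ ι (-(Fintype.card (fixedSub ι) * Fintype.card (commonFixed σ ι)))
      = (params ι (IsSpecial σ ι)).image (pairOf σ ι) := by
  obtain ⟨he, hl, hq⟩ := h.card_bounds
  refine Finset.Subset.antisymm (fun ab hab => ?_) fun ab hab => h.mem_pairsWith_of_isSpecial hψ hab
  rcases h.pair_cases hψ (mem_pairsWith.mp hab).1 with rfl | h1 | h1 | h1 | h1
  · have := eq_of_mem_pairsWith hab zero_mem_pairsWith; nlinarith
  · exact h1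
  · have := eq_of_mem_pairsWith hab (h.mem_pairsWith_of_not_isSpecial hψ hν h1); nlinarith
  · have := eq_of_mem_pairsWith hab h1; nlinarith
  · have := eq_of_mem_pairsWith hab h1; nlinarith

lemma pairsWith_zero (h : CommutingPair σ ι) {ψ : AddChar K ℂ} (hψ : ψ ≠ 1)
    {ν : K} (hν : ¬ IsSquare (algebraMap K (commonFixed σ ι) ν)) :
    pairsWith σ ι 0 = (params ι fun u => ¬ IsSpecial σ ι u).image (pairOf σ ι) := by
  obtain ⟨he, hl, hq⟩ := h.card_bounds
  refine Finset.Subset.antisymm (fun ab hab => ?_) fun ab hab =>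
    h.mem_pairsWith_of_not_isSpecial hψ hν hab
  rcases h.pair_cases hψ (mem_pairsWith.mp hab).1 with rfl | h1 | h1 | h1 | h1
  · have := eq_of_mem_pairsWith hab zero_mem_pairsWith; nlinarith
  · have := eq_of_mem_pairsWith hab (h.mem_pairsWith_of_isSpecial hψ h1); nlinarith
  · exact h1
  · have := eq_of_mem_pairsWith hab h1; nlinarith
  · have := eq_of_mem_pairsWith hab h1; nlinarith

lemma pairsWith_card (h : CommutingPair σ ι) {ψ : AddChar K ℂ} (hψ : ψ ≠ 1)
    {ν : K} (hν : ¬ IsSquare (algebraMap K (commonFixed σ ι) ν)) :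
    pairsWith σ ι (Fintype.card F) = {(0, 0)} := by
  obtain ⟨he, hl, hq⟩ := h.card_bounds
  refine Finset.Subset.antisymm (fun ab hab => ?_) fun ab hab => by
    rw [Finset.mem_singleton.mp hab]; exact zero_mem_pairsWith
  rcases h.pair_cases hψ (mem_pairsWith.mp hab).1 with rfl | h1 | h1 | h1 | h1
  · simp
  · have := eq_of_mem_pairsWith hab (h.mem_pairsWith_of_isSpecial hψ h1); nlinarith
  · have := eq_of_mem_pairsWith hab (h.mem_pairsWith_of_not_isSpecial hψ hν h1); nlinarith
  · have := eq_of_mem_pairsWith hab h1; nlinarith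
  · have := eq_of_mem_pairsWith hab h1; nlinarith

/-- Summation over all pairs of a function of the deviation. -/
lemma sum_pairs (h : CommutingPair σ ι) {ψ : AddChar K ℂ} (hψ : ψ ≠ 1)
    {ν : K} (hν : ¬ IsSquare (algebraMap K (commonFixed σ ι) ν)) {f : F × F → ℤ} {g : ℤ → ℤ}
    (hfg : ∀ τ, ∀ ab ∈ pairsWith σ ι τ, f ab = g τ) :
    ∑ ab ∈ Finset.univ.filter (fun ab : F × F => ι ab.1 = ab.1), f ab
      = (pairsWith σ ι (Fintype.card (fixedSub ι))).card * g (Fintype.card (fixedSub ι))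
        + (pairsWith σ ι 0).card * g 0
        + (pairsWith σ ι (-Fintype.card (fixedSub ι))).card * g (-Fintype.card (fixedSub ι))
        + (pairsWith σ ι (-(Fintype.card (fixedSub ι) * Fintype.card (commonFixed σ ι)))).card
          * g (-(Fintype.card (fixedSub ι) * Fintype.card (commonFixed σ ι)))
        + g (Fintype.card F) := by
  obtain ⟨he, hl, hq⟩ := h.card_bounds
  set e : ℤ := ((Fintype.card (fixedSub ι) : ℕ) : ℤ)
  set l : ℤ := ((Fintype.card (commonFixed σ ι) : ℕ) : ℤ)
  have hdis {τ τ' : ℤ} (hne : τ ≠ τ') : Disjoint (pairsWith σ ι τ) (pairsWith σ ι τ') :=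
    Finset.disjoint_left.mpr fun _ h1 h2 => hne (eq_of_mem_pairsWith h1 h2)
  have hsum (τ : ℤ) : ∑ ab ∈ pairsWith σ ι τ, f ab = (pairsWith σ ι τ).card * g τ := by
    rw [Finset.sum_congr rfl (hfg τ), Finset.sum_const, nsmul_eq_mul]
  have hset : Finset.univ.filter (fun ab : F × F => ι ab.1 = ab.1)
      = ({e, 0, -e, -(e * l), (Fintype.card F : ℤ)} : Finset ℤ).biUnion (pairsWith σ ι) := by
    ext ab
    simp only [Finset.mem_filter, Finset.mem_univ, true_and, Finset.mem_biUnion,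
      Finset.mem_insert, Finset.mem_singleton, exists_eq_or_imp, exists_eq_left]
    refine ⟨h.mem_pairsWith_cases hψ hν, ?_⟩
    rintro (h1 | h1 | h1 | h1 | h1) <;> exact (mem_pairsWith.mp h1).1
  have hone := congrArg Finset.card (h.pairsWith_card hψ hν)
  rw [Finset.card_singleton] at hone
  rw [hset, Finset.sum_biUnion fun τ _ τ' _ hne => hdis hne]
  have e1 : e ≠ 0 ∧ e ≠ -e ∧ e ≠ -(e * l) ∧ e ≠ Fintype.card F :=
    ⟨by nlinarith, by nlinarith, by nlinarith, by nlinarith⟩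
  have e2 : (0 : ℤ) ≠ -e ∧ 0 ≠ -(e * l) ∧ (0 : ℤ) ≠ Fintype.card F :=
    ⟨by nlinarith, by nlinarith, by nlinarith⟩
  have e3 : -e ≠ -(e * l) ∧ -e ≠ Fintype.card F := ⟨by nlinarith, by nlinarith⟩
  have e4 : -(e * l) ≠ Fintype.card F := by nlinarith
  rw [Finset.sum_insert (by simp [-zero_eq_neg, -neg_inj, e1]),
    Finset.sum_insert (by simp only [Finset.mem_insert, Finset.mem_singleton]; tauto),
    Finset.sum_insert (by simp only [Finset.mem_insert, Finset.mem_singleton]; tauto),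
    Finset.sum_insert (by simp only [Finset.mem_singleton]; tauto), Finset.sum_singleton]
  simp only [hsum, hone]
  push_cast
  ring

omit [Fintype K] in
lemma card_pairs (h : CommutingPair σ ι) :
    (Finset.univ.filter fun ab : F × F => ι ab.1 = ab.1).card = Fintype.card (fixedSub ι) ^ 3 := by
  have : (Finset.univ.filter fun ab : F × F => ι ab.1 = ab.1)
      = (Finset.univ.filter fun a : F => ι a = a) ×ˢ Finset.univ := by ext; simp
  rw [this, Finset.card_product, card_filter_fixed, Finset.card_univ, h.card_eq_sq]
  ring

/-- First moment of the number of zeros. -/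
lemma sum_zeroCount (h : CommutingPair σ ι) {ψ : AddChar K ℂ} (hψ : ψ ≠ 1) :
    ∑ ab ∈ Finset.univ.filter (fun ab : F × F => ι ab.1 = ab.1),
        (Fintype.card K : ℤ) * zeroCount σ ι ab.1 ab.2
      = Fintype.card K * Fintype.card (fixedSub ι) ^ 3
        + (Fintype.card (fixedSub ι) ^ 2 - 1) * Fintype.card (fixedSub ι) ^ 3 := by
  have hset : (Finset.univ.filter fun ab : F × F => ι ab.1 = ab.1)
      = (Finset.univ.filter fun a : F => ι a = a) ×ˢ Finset.univ := by ext; simp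
  have hβ (α x : F) (hx : x ≠ 0) : (Fintype.card K : ℤ) * (Finset.univ.filter fun β : F =>
      Algebra.trace K F (pairForm σ ι α β x) = 0).card = Fintype.card F := by
    have h1 := card_mul_card_zeros hψ fun β : F => Algebra.trace K F (pairForm σ ι α β x)
    rw [Finset.sum_eq_zero (s := Finset.univ.filter fun c : K => c ≠ 0), add_zero] at h1
    · exact_mod_cast h1
    · intro c hc
      have hc0 : algebraMap K F c ≠ 0 := by simpa using (Finset.mem_filter.mp hc).2
      have h2 (β : F) : ψ (c * Algebra.trace K F (pairForm σ ι α β x))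
          = traceChar F ψ (algebraMap K F c * (α * (x * ι x) / 2))
            * traceChar F ψ (algebraMap K F c * (x * σ x) * β) := by
        rw [← AddChar.map_add_eq_mul, traceChar_apply, ← smul_eq_mul, ← map_smul,
          Algebra.smul_def, pairForm]
        ring_nf
      rw [Finset.sum_congr rfl fun β _ => h2 β, ← Finset.mul_sum,
        AddChar.sum_mul_eq_zero (traceChar_ne_one hψ)
          (mul_ne_zero hc0 (mul_ne_zero hx (by simpa using hx))), mul_zero]
  have hx (α x : F) : (Fintype.card K : ℤ) * (Finset.univ.filter fun β : F =>
      Algebra.trace K F (pairForm σ ι α β x) = 0).card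
        = if x = 0 then (Fintype.card K : ℤ) * Fintype.card F else Fintype.card F := by
    split_ifs with h0
    · simp [h0, pairForm]
    · exact hβ α x h0
  have hswap (α : F) : ∑ β, (Fintype.card K : ℤ) * zeroCount σ ι α β
      = ∑ x, (Fintype.card K : ℤ) * (Finset.univ.filter fun β : F =>
        Algebra.trace K F (pairForm σ ι α β x) = 0).card := by
    simp only [zeroCount, Finset.card_filter, ← Finset.mul_sum]
    push_cast
    rw [Finset.sum_comm]
  rw [hset, Finset.sum_product]
  simp only [hswap, hx]
  rw [Finset.sum_const, card_filter_fixed, ← Finset.add_sum_erase _ _ (Finset.mem_univ 0),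
    if_pos rfl, Finset.sum_congr rfl fun x hx => if_neg (Finset.ne_of_mem_erase hx),
    Finset.sum_const, Finset.card_erase_of_mem (Finset.mem_univ _), Finset.card_univ]
  obtain ⟨he, hl, hq⟩ := h.card_bounds
  simp only [nsmul_eq_mul]
  rw [Nat.cast_sub Fintype.card_pos, hq]
  push_cast
  ring

section counts

variable (h : CommutingPair σ ι) {ψ : AddChar K ℂ} (hψ : ψ ≠ 1)
  {ν : K} (hν : ¬ IsSquare (algebraMap K (commonFixed σ ι) ν)) {e l : ℤ}
  (he : Fintype.card (fixedSub ι) = e) (hl : Fintype.card (commonFixed σ ι) = l)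
include h hψ hν he hl

lemma card_pairsWith_zero : ((pairsWith σ ι 0).card : ℤ) * l = (e ^ 2 - 1) * e := by
  rw [h.pairsWith_zero hψ hν, ← he, ← hl, h.card_image_not_isSpecial]

lemma card_pairsWith_neg_mul :
    ((pairsWith σ ι (-(e * l))).card : ℤ) * (l ^ 2 - 1) * l = (e ^ 2 - 1) * (e - l) := by
  rw [← he, ← hl, h.pairsWith_neg_mul hψ hν, h.card_image_isSpecial]

lemma card_pairsWith_add :
    ((pairsWith σ ι e).card : ℤ) + (pairsWith σ ι 0).card + (pairsWith σ ι (-e)).card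
      + (pairsWith σ ι (-(e * l))).card + 1 = e ^ 3 := by
  have h1 := h.sum_pairs hψ hν (f := fun _ => 1) (g := fun _ => 1) fun _ _ _ => rfl
  simp only [Finset.sum_const, nsmul_eq_mul, mul_one, he, hl, h.card_pairs] at h1
  rw [← h1]
  push_cast
  rw [he]

lemma moment_pairsWith :
    ((pairsWith σ ι e).card : ℤ) * e - (pairsWith σ ι (-e)).card * e
      - (pairsWith σ ι (-(e * l))).card * (e * l) + e ^ 2 = e ^ 3 := by
  have h1 := h.sum_pairs hψ hν (f := fun ab => (Fintype.card K : ℤ) * zeroCount σ ι ab.1 ab.2)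
    (g := fun τ => Fintype.card F + (Fintype.card K - 1) * τ)
    fun τ ab hab => (mem_pairsWith.mp hab).2
  rw [h.sum_zeroCount hψ] at h1
  have h2 := h.card_pairsWith_add hψ hν he hl
  have hK : (1 : ℤ) < Fintype.card K := by exact_mod_cast Fintype.one_lt_card
  have hq := h.card_bounds.2.2
  simp only [he, hl, hq] at h1
  apply mul_left_cancel₀ (sub_pos.mpr hK).ne'
  linear_combination -h1 - e ^ 2 * h2

lemma card_pairsWith_self :
    2 * (l + 1) * ((pairsWith σ ι e).card : ℤ) = l * (e - 1) * (e + 1) ^ 2 := by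
  have h0 := h.card_pairsWith_zero hψ hν he hl
  have h1 := h.card_pairsWith_neg_mul hψ hν he hl
  have h2 := h.card_pairsWith_add hψ hν he hl
  have h3 := h.moment_pairsWith hψ hν he hl
  obtain ⟨he1, hl1, -⟩ := h.card_bounds
  rw [he] at he1
  rw [hl] at hl1
  have h4 : e * (l * (l - 1)) ≠ 0 := by
    have := sub_pos.mpr hl1
    positivity
  apply mul_right_cancel₀ h4
  linear_combination (e * l * (l ^ 2 - 1)) * h2 + (l * (l ^ 2 - 1)) * h3 - (e * (l ^ 2 - 1)) * h0
    - (e * (1 - l)) * h1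

lemma card_pairsWith_neg :
    2 * (l - 1) * l * ((pairsWith σ ι (-e)).card : ℤ)
      = l * (e - 1) * (l * e ^ 2 - 2 * e ^ 2 + l) := by
  have h0 := h.card_pairsWith_zero hψ hν he hl
  have h1 := h.card_pairsWith_neg_mul hψ hν he hl
  have h2 := h.card_pairsWith_add hψ hν he hl
  have h3 := h.moment_pairsWith hψ hν he hl
  obtain ⟨he1, hl1, -⟩ := h.card_bounds
  rw [he] at he1
  rw [hl] at hl1
  have h4 : e * (l + 1) ≠ 0 := by positivity
  apply mul_right_cancel₀ h4
  linear_combination (e * l * (l ^ 2 - 1)) * h2 - (l * (l ^ 2 - 1)) * h3 - (e * (l ^ 2 - 1)) * h0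
    - (e * (1 + l)) * h1

end counts

end CommutingPair

lemma card_filter_pow_eq_self {p n j : ℕ} (hp : p.Prime) (hj : 0 < j) (hjn : j ∣ n)
    {F : Type*} [Field F] [Fintype F] (hF : Fintype.card F = p ^ n) :
    (Finset.univ.filter fun x : F => x ^ p ^ j = x).card = p ^ j := by
  have hpj : 1 < p ^ j := Nat.one_lt_pow hj.ne' hp.one_lt
  have h1 : (Finset.univ.filter fun u : Fˣ => u ^ (p ^ j - 1) = 1).card = p ^ j - 1 := by
    have h3 : Nat.card {u : Fˣ // u ^ (p ^ j - 1) = 1}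
        = Nat.card (powMonoidHom (p ^ j - 1) : Fˣ →* Fˣ).ker := rfl
    rw [← Fintype.card_subtype, ← Nat.card_eq_fintype_card, h3, IsCyclic.card_powMonoidHom_ker,
      Nat.card_units, Nat.card_eq_fintype_card, hF]
    exact Nat.gcd_eq_right (Nat.pow_sub_one_dvd_pow_sub_one p hjn)
  have h2 : ((Finset.univ.filter fun x : F => x ^ p ^ j = x).erase 0).card = p ^ j - 1 := by
    rw [← h1]
    symm
    refine Finset.card_bij (fun u _ => (u : F)) ?_ (fun u _ v _ huv => Units.ext huv) ?_
    · intro u hu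
      have hu1 : u ^ (p ^ j - 1) = 1 := (Finset.mem_filter.mp hu).2
      have hu2 : (u : F) ^ (p ^ j - 1) = 1 := by rw [← Units.val_pow_eq_pow_val, hu1, Units.val_one]
      simp only [Finset.mem_erase, ne_eq, Units.ne_zero, not_false_eq_true, Finset.mem_filter,
        Finset.mem_univ, true_and]
      rw [← Nat.sub_add_cancel hpj.le, pow_succ, hu2, one_mul]
    · intro x hx
      obtain ⟨hx0, hx⟩ := Finset.mem_erase.mp hx
      refine ⟨Units.mk0 x hx0, ?_, rfl⟩
      have hx1 : x ^ (p ^ j - 1) = 1 := by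
        apply mul_right_cancel₀ hx0
        rw [← pow_succ, Nat.sub_add_cancel hpj.le, one_mul]
        exact (Finset.mem_filter.mp hx).2
      simp [Units.ext_iff, hx1]
  rw [← Finset.card_erase_add_one (a := 0) (by simp [hp.pos.ne']), h2, Nat.sub_add_cancel hpj.le]

lemma pow_gcd_eq_self {p i j : ℕ} {F : Type*} [Monoid F] {x : F} (hi : x ^ p ^ i = x)
    (hj : x ^ p ^ j = x) : x ^ p ^ Nat.gcd i j = x := by
  have h (r : ℕ) : Function.IsPeriodicPt (fun y : F => y ^ p) r x ↔ x ^ p ^ r = x := by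
    rw [Function.IsPeriodicPt, Function.IsFixedPt, pow_iterate]
  exact (h _).mp (((h i).mpr hi).gcd ((h j).mpr hj))

lemma pow_eq_self_of_dvd {p i j : ℕ} {F : Type*} [Monoid F] {x : F} (hi : x ^ p ^ i = x)
    (hij : i ∣ j) : x ^ p ^ j = x := by
  have h (r : ℕ) : Function.IsPeriodicPt (fun y : F => y ^ p) r x ↔ x ^ p ^ r = x := by
    rw [Function.IsPeriodicPt, Function.IsFixedPt, pow_iterate]
  exact (h _).mp (((h i).mpr hi).trans_dvd hij)

/-- The automorphism `x ↦ x ^ (|K| ^ j)`. -/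
def frobPow (K F : Type*) [Field K] [Field F] [Fintype K] [Finite F] [Algebra K F] (j : ℕ) :
    F ≃ₐ[K] F :=
  FiniteField.frobeniusAlgEquivOfAlgebraic K F ^ j

section instantiate

variable {p m n k t d : ℕ} {K F : Type} [Field K] [Field F] [Fintype K] [Fintype F] [Algebra K F]
  (hK : Fintype.card K = p ^ t)
include hK

omit [Fintype F] in
lemma frobPow_apply [Finite F] {j : ℕ} (hj : t ∣ j) (x : F) : frobPow K F (j / t) x = x ^ p ^ j := by
  rw [frobPow, AlgEquiv.coe_pow, FiniteField.coe_frobeniusAlgEquivOfAlgebraic_iterate]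
  simp only
  rw [hK, ← pow_mul, Nat.mul_div_cancel' hj]

lemma card_fixedSub_frobPow (hp : p.Prime) {j : ℕ} (hj : t ∣ j) (hj0 : 0 < j) (hjn : j ∣ n)
    (hF : Fintype.card F = p ^ n) : Fintype.card (fixedSub (frobPow K F (j / t))) = p ^ j := by
  rw [← card_filter_pow_eq_self hp hj0 hjn hF, ← Fintype.card_subtype]
  exact Fintype.card_congr (Equiv.subtypeEquivRight fun x => by
    rw [mem_fixedSub, frobPow_apply hK hj])

lemma card_commonFixed_frobPow (hp : p.Prime) (hk : t ∣ k) (hm : t ∣ m) (hm0 : 0 < m)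
    (hmn : m ∣ n) (hF : Fintype.card F = p ^ n) :
    Fintype.card (CommutingPair.commonFixed (frobPow K F (k / t)) (frobPow K F (m / t)))
      = p ^ Nat.gcd m k := by
  rw [← card_filter_pow_eq_self hp (Nat.gcd_pos_of_pos_left k hm0)
    ((Nat.gcd_dvd_left m k).trans hmn) hF, ← Fintype.card_subtype]
  refine Fintype.card_congr (Equiv.subtypeEquivRight fun x => ?_)
  rw [IntermediateField.mem_inf, mem_fixedSub, mem_fixedSub, frobPow_apply hK hk,
    frobPow_apply hK hm]
  exact ⟨fun h => pow_gcd_eq_self h.2 h.1, fun h =>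
    ⟨pow_eq_self_of_dvd h (Nat.gcd_dvd_right m k), pow_eq_self_of_dvd h (Nat.gcd_dvd_left m k)⟩⟩

lemma commutingPair_frobPow (hp : p.Prime) (h2 : (2 : F) ≠ 0) (hk : t ∣ k) (hm : t ∣ m)
    (hm0 : 0 < m) (hF : Fintype.card F = p ^ (2 * m)) (hgcd : Nat.gcd (m + k) (2 * k) ∣ m) :
    CommutingPair (frobPow K F (k / t)) (frobPow K F (m / t)) where
  two_ne_zero := h2
  invol x := by
    rw [frobPow_apply hK hm, frobPow_apply hK hm, ← pow_mul, ← pow_add, ← two_mul, ← hF,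
      FiniteField.pow_card]
  comm x := by
    simp only [frobPow_apply hK hm, frobPow_apply hK hk]
    exact pow_right_comm _ _ _
  eq_zero_of_anti v hιv hσv := by
    have h1 : v ^ p ^ (m + k) = v := by
      rw [pow_add, pow_mul, ← frobPow_apply hK hm, ← frobPow_apply hK hk, hιv, map_neg, hσv,
        neg_neg]
    have h3 : v ^ p ^ (2 * k) = v := by
      rw [two_mul, pow_add, pow_mul, ← frobPow_apply hK hk, ← frobPow_apply hK hk, hσv, map_neg,
        hσv, neg_neg]
    have h4 := pow_eq_self_of_dvd (pow_gcd_eq_self h1 h3) hgcd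
    rw [← frobPow_apply hK hm, hιv, neg_eq_iff_add_eq_zero, ← two_mul] at h4
    exact (mul_eq_zero.mp h4).resolve_left h2
  exists_anti := by
    obtain ⟨x, hx⟩ : ∃ x : F, frobPow K F (m / t) x ≠ x := by
      by_contra! hall
      have h1 := card_filter_pow_eq_self hp hm0 (Dvd.intro_left 2 rfl) hF
      rw [Finset.filter_true_of_mem fun x _ => by rw [← frobPow_apply hK hm, hall],
        Finset.card_univ, hF] at h1
      have := Nat.pow_right_injective hp.two_le h1
      omega
    refine ⟨frobPow K F (m / t) x - x, sub_ne_zero.mpr hx, ?_⟩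
    rw [map_sub, frobPow_apply hK hm, frobPow_apply hK hm, ← pow_mul, ← pow_add, ← two_mul, ← hF,
      FiniteField.pow_card]
    ring

omit [Fintype F] in
/-- Nonsquares stay nonsquare in extensions of odd degree. -/
lemma exists_not_isSquare (S : IntermediateField K F) [Fintype S]
    (hS : Fintype.card S = p ^ d) (htd : t ∣ d) (hodd : (d / t) % 2 = 1) (h2 : (2 : F) ≠ 0) :
    ∃ ν : K, ¬ IsSquare (algebraMap K S ν) := by
  have hchar : ringChar K ≠ 2 := by
    intro h
    apply h2
    have h3 : (2 : K) = 0 := by exact_mod_cast h ▸ CharP.cast_eq_zero K (ringChar K)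
    rw [← map_ofNat (algebraMap K F), h3, map_zero]
  obtain ⟨ν, hν⟩ := FiniteField.exists_nonsquare hchar
  have hν0 : ν ≠ 0 := by rintro rfl; exact hν IsSquare.zero
  refine ⟨ν, fun ⟨s, hs⟩ => ?_⟩
  have h3 := (FiniteField.pow_dichotomy hchar hν0).resolve_left
    (mt (FiniteField.isSquare_iff hchar hν0).mpr hν)
  have hs0 : s ≠ 0 := by rintro rfl; simp [hν0] at hs
  have h4 : s ^ Fintype.card K = -s := by
    have hc : Fintype.card K = 2 * (Fintype.card K / 2) + 1 := by
      have := FiniteField.odd_card_of_char_ne_two hchar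
      omega
    rw [hc, pow_succ, pow_mul, sq, ← hs, ← map_pow, h3, map_neg, map_one, neg_one_mul]
  have h5 (j : ℕ) : s ^ Fintype.card K ^ j = (-1) ^ j * s := by
    induction j with
    | zero => simp
    | succ j ih =>
      have hKodd : Odd (Fintype.card K) :=
        Nat.odd_iff.mpr (FiniteField.odd_card_of_char_ne_two hchar)
      rw [pow_succ, pow_mul, ih, mul_pow, h4, ← pow_mul, mul_comm j, pow_mul, hKodd.neg_one_pow]
      ring
  have h6 := h5 (d / t)
  rw [hK, ← pow_mul, Nat.mul_div_cancel' htd, ← hS, FiniteField.pow_card,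
    (Nat.odd_iff.mpr hodd).neg_one_pow] at h6
  have h7 : (2 : S) * s = 0 := by linear_combination h6
  rcases mul_eq_zero.mp h7 with h8 | h8
  · exact h2 (congrArg Subtype.val h8)
  · exact hs0 h8

lemma finrank_eq_div (hp : 1 < p) (ht : 0 < t) (hF : Fintype.card F = p ^ n) :
    Module.finrank K F = n / t := by
  have h := Module.card_eq_pow_finrank (K := K) (V := F)
  rw [hK, hF, ← pow_mul] at h
  rw [Nat.pow_right_injective hp h, Nat.mul_div_cancel_left _ ht]

lemma algebraMap_trace_eq_trSum (hp : 1 < p) (ht : 0 < t) (hF : Fintype.card F = p ^ n) (x : F) :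
    algebraMap K F (Algebra.trace K F x) = trSum p t (n / t) x := by
  rw [FiniteField.algebraMap_trace_eq_sum_pow, finrank_eq_div hK hp ht hF, trSum]
  simp only [Nat.card_eq_fintype_card, hK, ← pow_mul]

lemma algebraMap_trace_half (hp : 1 < p) (ht : 0 < t) (hm : t ∣ m) (h2 : (2 : F) ≠ 0)
    (hF : Fintype.card F = p ^ (2 * m)) {z : F} (hz : z ^ p ^ m = z) :
    algebraMap K F (Algebra.trace K F (z / 2)) = trSum p t (m / t) z := by
  apply mul_left_cancel₀ h2
  have h1 : (2 : F) * algebraMap K F (Algebra.trace K F (z / 2))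
      = algebraMap K F (Algebra.trace K F z) := by
    rw [two_mul, ← map_add, ← map_add, ← add_div, ← two_mul, mul_div_cancel_left₀ _ h2]
  rw [h1, algebraMap_trace_eq_trSum hK hp ht hF, Nat.mul_div_assoc _ hm, two_mul, two_mul, trSum,
    trSum, Finset.sum_range_add]
  congr 1
  refine Finset.sum_congr rfl fun i _ => ?_
  rw [mul_add, Nat.mul_div_cancel' hm, pow_add, pow_mul, hz]

lemma trSum_add_trSum (hp : 1 < p) (ht : 0 < t) (hm : t ∣ m) (hk : t ∣ k) (h2 : (2 : F) ≠ 0)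
    (hF : Fintype.card F = p ^ (2 * m)) {α : F} (hα : α ^ p ^ m = α) (β x : F) :
    trSum p t (m / t) (α * x ^ (p ^ m + 1)) + trSum p t (2 * m / t) (β * x ^ (p ^ k + 1))
      = algebraMap K F (Algebra.trace K F
        (pairForm (frobPow K F (k / t)) (frobPow K F (m / t)) α β x)) := by
  have hx : (x ^ (p ^ m + 1)) ^ p ^ m = x ^ (p ^ m + 1) := by
    rw [← pow_mul, add_mul, one_mul, ← pow_add, ← two_mul, pow_add, ← hF, FiniteField.pow_card,
      pow_succ']
  rw [← algebraMap_trace_half hK hp ht hm h2 hF (by rw [mul_pow, hα, hx]),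
    ← algebraMap_trace_eq_trSum hK hp ht hF, ← map_add, ← map_add, pairForm,
    frobPow_apply hK hm, frobPow_apply hK hk, pow_succ', pow_succ']

lemma wt1_add_zeroCount (hp : 1 < p) (ht : 0 < t) (hm : t ∣ m) (hm0 : 0 < m)
    (hk : t ∣ k) (h2 : (2 : F) ≠ 0) (hF : Fintype.card F = p ^ (2 * m)) {π : F}
    (hπ : ∀ x : F, x ≠ 0 → ∃ i : ℕ, π ^ i = x) {α : F} (hα : α ^ p ^ m = α) (β : F) :
    wt1 p m (2 * m) k t π α β
      + CommutingPair.zeroCount (frobPow K F (k / t)) (frobPow K F (m / t)) α β = p ^ (2 * m) := by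
  set σ := frobPow K F (k / t)
  set ι := frobPow K F (m / t)
  have hq : 2 ≤ p ^ (2 * m) := Nat.one_lt_pow (by omega) hp
  have hπ0 : π ≠ 0 := by
    rintro rfl
    obtain ⟨i, hi⟩ := hπ (-1) (by simp)
    rcases Nat.eq_zero_or_pos i with rfl | h0
    · apply h2
      rw [pow_zero] at hi
      linear_combination hi
    · rw [zero_pow h0.ne'] at hi
      simp at hi
  have hπ1 : π ^ (p ^ (2 * m) - 1) = 1 := by
    rw [← hF]; exact FiniteField.pow_card_sub_one_eq_one π hπ0
  have hmaps : ∀ i ∈ Finset.range (p ^ (2 * m) - 1), π ^ i ∈ Finset.univ.erase (0 : F) := by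
    intro i _
    simp [hπ0]
  have hsurj : ∀ x ∈ Finset.univ.erase (0 : F), ∃ i ∈ Finset.range (p ^ (2 * m) - 1), π ^ i = x := by
    intro x hx
    obtain ⟨i, rfl⟩ := hπ x (Finset.ne_of_mem_erase hx)
    refine ⟨i % (p ^ (2 * m) - 1), Finset.mem_range.mpr (Nat.mod_lt _ (by omega)), ?_⟩
    conv_rhs => rw [← Nat.mod_add_div i (p ^ (2 * m) - 1), pow_add, pow_mul π, hπ1, one_pow, mul_one]
  have hinj := Finset.inj_on_of_surj_on_of_card_le (s := Finset.range (p ^ (2 * m) - 1))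
    (t := Finset.univ.erase (0 : F)) (fun i _ => π ^ i) hmaps
    (by simpa only [exists_prop] using hsurj)
    (by rw [Finset.card_range, Finset.card_erase_of_mem (Finset.mem_univ _), Finset.card_univ, hF])
  have hterm (i : ℕ) : trSum p t (m / t) (α * π ^ (i * (p ^ m + 1))) +
      trSum p t (2 * m / t) (β * π ^ (i * (p ^ k + 1))) ≠ 0 ↔
      Algebra.trace K F (pairForm σ ι α β (π ^ i)) ≠ 0 := by
    rw [pow_mul, pow_mul, trSum_add_trSum hK hp ht hm hk h2 hF hα]
    simp [σ, ι]
  have h1 : wt1 p m (2 * m) k t π α β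
      = (Finset.univ.filter fun x : F => ¬ Algebra.trace K F (pairForm σ ι α β x) = 0).card := by
    rw [wt1, Nat.card_congr (Equiv.subtypeEquivRight
      (q := fun i => i ∈ (Finset.range (p ^ (2 * m) - 1)).filter fun i =>
        Algebra.trace K F (pairForm σ ι α β (π ^ i)) ≠ 0) fun i => by
      rw [hterm, Finset.mem_filter, Finset.mem_range]
      exact and_congr_left fun _ => by omega), Nat.card_eq_fintype_card, Fintype.card_coe]
    refine Finset.card_bij (fun i _ => π ^ i) ?_ ?_ ?_
    · intro i hi
      exact Finset.mem_filter.mpr ⟨Finset.mem_univ _, (Finset.mem_filter.mp hi).2⟩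
    · intro i hi j hj hij
      exact hinj (Finset.mem_filter.mp hi).1 (Finset.mem_filter.mp hj).1 hij
    · intro x hx
      have hx' := (Finset.mem_filter.mp hx).2
      have hx0 : x ≠ 0 := by
        rintro rfl
        exact hx' (by simp [pairForm])
      obtain ⟨i, hi, rfl⟩ := hsurj x (Finset.mem_erase.mpr ⟨hx0, Finset.mem_univ _⟩)
      exact ⟨i, Finset.mem_filter.mpr ⟨hi, hx'⟩, rfl⟩
  rw [h1, CommutingPair.zeroCount, add_comm, Finset.card_filter_add_card_filter_not,
    Finset.card_univ, hF]

lemma wt1_eq_iff_mem_pairsWith (hp : 1 < p) (ht : 0 < t) (hm : t ∣ m)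
    (hm0 : 0 < m) (hk : t ∣ k) (h2 : (2 : F) ≠ 0) (hF : Fintype.card F = p ^ (2 * m)) {π : F}
    (hπ : ∀ x : F, x ≠ 0 → ∃ i : ℕ, π ^ i = x) {v : ℕ} {τ : ℤ}
    (hv : (p : ℤ) ^ t * v = ((p : ℤ) ^ t - 1) * ((p : ℤ) ^ (2 * m) - τ)) (ab : F × F) :
    ab ∈ CommutingPair.pairsWith (frobPow K F (k / t)) (frobPow K F (m / t)) τ ↔
      ab.1 ^ p ^ m = ab.1 ∧ wt1 p m (2 * m) k t π ab.1 ab.2 = v := by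
  rw [CommutingPair.mem_pairsWith, frobPow_apply hK hm]
  refine and_congr_right fun hα => ?_
  have h1 := wt1_add_zeroCount hK hp ht hm hm0 hk h2 hF hπ hα ab.2
  have hpt : (p : ℤ) ^ t ≠ 0 := pow_ne_zero _ (by exact_mod_cast (zero_lt_one.trans hp).ne')
  rw [hK, hF]
  zify at h1 ⊢
  constructor
  · intro h
    apply mul_left_cancel₀ hpt
    linear_combination (p : ℤ) ^ t * h1 - h - hv
  · intro h
    rw [h] at h1
    linear_combination (p : ℤ) ^ t * h1 - hv

lemma wt1count_eq_card_pairsWith (hp : 1 < p) (ht : 0 < t) (hm : t ∣ m)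
    (hm0 : 0 < m) (hk : t ∣ k) (h2 : (2 : F) ≠ 0) (hF : Fintype.card F = p ^ (2 * m)) {π : F}
    (hπ : ∀ x : F, x ≠ 0 → ∃ i : ℕ, π ^ i = x) {v : ℕ} {τ : ℤ}
    (hv : (p : ℤ) ^ t * v = ((p : ℤ) ^ t - 1) * ((p : ℤ) ^ (2 * m) - τ)) :
    wt1count p m (2 * m) k t F π v
      = (CommutingPair.pairsWith (frobPow K F (k / t)) (frobPow K F (m / t)) τ).card := by
  rw [wt1count, ← Fintype.card_coe, ← Nat.card_eq_fintype_card]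
  exact Nat.card_congr (Equiv.subtypeEquivRight fun ab =>
    (wt1_eq_iff_mem_pairsWith hK hp ht hm hm0 hk h2 hF hπ hv ab).symm)

end instantiate

lemma two_ne_zero_of_odd {p : ℕ} (hp : p.Prime) (hodd : p % 2 = 1)
    (F : Type*) [Field F] [Algebra (ZMod p) F] : (2 : F) ≠ 0 := by
  have : Fact p.Prime := ⟨hp⟩
  have : CharP F p := charP_of_injective_algebraMap (algebraMap (ZMod p) F).injective p
  apply Ring.two_ne_zero
  rw [ringChar.eq F p]
  rintro rfl
  simp at hodd

lemma exists_subfield_card_eq {p n t : ℕ} (hp : p.Prime)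
    (F : Type) [Field F] [Fintype F] [Algebra (ZMod p) F] (hF : Fintype.card F = p ^ n)
    (ht0 : 0 < t) (ht : t ∣ n) :
    ∃ (K : Type) (_ : Field K) (_ : Fintype K) (_ : Algebra K F),
      Fintype.card K = p ^ t := by
  have : Fact p.Prime := ⟨hp⟩
  have hfin : Module.finrank (ZMod p) F = n := by
    apply Nat.pow_right_injective hp.two_le
    simp only
    rw [FiniteField.pow_finrank_eq_card, hF]
  obtain ⟨f⟩ := FiniteField.nonempty_algHom_of_finrank_dvd (F := ZMod p)
    (K := GaloisField p t) (L := F) (by rwa [GaloisField.finrank p ht0.ne', hfin])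
  let _ : Fintype (GaloisField p t) := Fintype.ofFinite _
  exact ⟨GaloisField p t, inferInstance, inferInstance, f.toRingHom.toAlgebra, by
    rw [← Nat.card_eq_fintype_card, GaloisField.card p t ht0.ne']⟩

theorem stmt11 (p m k n d d' : ℕ) (hp : Nat.Prime p) (hodd : p % 2 = 1)
    (hm : 0 < m) (hn : n = 2 * m) (hk : k ≤ n - 1) (hkm : k ≠ m)
    (hd : d = Nat.gcd m k) (hd' : d' = Nat.gcd (m + k) (2 * k))
    (F : Type) [Field F] [Fintype F] [Algebra (ZMod p) F] (hF : Fintype.card F = p ^ n) (t : ℕ) (ht0 : 0 < t) (ht : t ∣ d)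
    (π : F) (hπ : ∀ x : F, x ≠ 0 → ∃ i : ℕ, π ^ i = x)
    (hcase : d' = d) (hdt : (d / t) % 2 = 1) :
    (2 * ((p : ℤ) ^ d + 1) *
        (wt1count p m n k t F π ((p ^ t - 1) * (p ^ (n - t) - p ^ (m - t))) : ℤ)
        = (p : ℤ) ^ d * ((p : ℤ) ^ m - 1) * ((p : ℤ) ^ m + 1) ^ 2) ∧
    ((wt1count p m n k t F π ((p ^ t - 1) * p ^ (n - t)) : ℤ)
        = (p : ℤ) ^ (m - d) * ((p : ℤ) ^ n - 1)) ∧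
    (2 * ((p : ℤ) ^ d - 1) *
        (wt1count p m n k t F π ((p ^ t - 1) * (p ^ (n - t) + p ^ (m - t))) : ℤ)
        = (p : ℤ) ^ d * ((p : ℤ) ^ m - 1) * ((p : ℤ) ^ n - 2 * (p : ℤ) ^ (n - d) + 1)) ∧
    (((p : ℤ) ^ (2 * d) - 1) *
        (wt1count p m n k t F π ((p ^ t - 1) * (p ^ (n - t) + p ^ (m + d - t))) : ℤ)
        = ((p : ℤ) ^ (m - d) - 1) * ((p : ℤ) ^ n - 1)) ∧
    (wt1count p m n k t F π 0 = 1) ∧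
    (∀ α β : F, α ^ p ^ m = α →
      wt1 p m n k t π α β = (p ^ t - 1) * (p ^ (n - t) - p ^ (m - t)) ∨
      wt1 p m n k t π α β = (p ^ t - 1) * p ^ (n - t) ∨
      wt1 p m n k t π α β = (p ^ t - 1) * (p ^ (n - t) + p ^ (m - t)) ∨
      wt1 p m n k t π α β = (p ^ t - 1) * (p ^ (n - t) + p ^ (m + d - t)) ∨
      wt1 p m n k t π α β = 0) := by
  subst hn
  have htm : t ∣ m := ht.trans (hd ▸ Nat.gcd_dvd_left m k)
  have htk : t ∣ k := ht.trans (hd ▸ Nat.gcd_dvd_right m k)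
  have hdm : d ∣ m := hd ▸ Nat.gcd_dvd_left m k
  have h2 := two_ne_zero_of_odd hp hodd F
  obtain ⟨K, _, _, _, hK⟩ := exists_subfield_card_eq hp F hF ht0 (htm.mul_left 2)
  have h := commutingPair_frobPow hK hp h2 htk htm hm hF (hd' ▸ hcase ▸ hdm)
  have hcE : Fintype.card (fixedSub (frobPow K F (m / t))) = p ^ m :=
    card_fixedSub_frobPow hK hp htm hm (Dvd.intro_left 2 rfl) hF
  have hcS : Fintype.card (CommutingPair.commonFixed (frobPow K F (k / t)) (frobPow K F (m / t)))
      = p ^ d := hd ▸ card_commonFixed_frobPow hK hp htk htm hm (Dvd.intro_left 2 rfl) hF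
  obtain ⟨ν, hν⟩ := exists_not_isSquare hK _ hcS ht hdt h2
  have hψ : AddChar.FiniteField.primitiveChar_to_Complex K ≠ 1 := by
    simpa using AddChar.FiniteField.primitiveChar_to_Complex_isPrimitive K one_ne_zero
  have hp0 : (0 : ℤ) < p := by exact_mod_cast hp.pos
  have hd0 : 0 < d := hd ▸ Nat.gcd_pos_of_pos_left k hm
  have htd := Nat.le_of_dvd hd0 ht
  have hdm' := Nat.le_of_dvd hm hdm
  have hp1 : ((p ^ t - 1 : ℕ) : ℤ) = (p : ℤ) ^ t - 1 := by
    rw [Nat.cast_sub (Nat.one_le_pow _ _ hp.pos)]; push_cast; rfl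
  have hpn : (p : ℤ) ^ t * p ^ (2 * m - t) = p ^ (2 * m) := by rw [← pow_add]; congr 1; omega
  have hpm : (p : ℤ) ^ t * p ^ (m - t) = p ^ m := by rw [← pow_add]; congr 1; omega
  have hpmd : (p : ℤ) ^ t * p ^ (m + d - t) = p ^ m * p ^ d := by
    rw [← pow_add, ← pow_add]; congr 1; omega
  have hv₁ : (p : ℤ) ^ t * ((p ^ t - 1) * (p ^ (2 * m - t) - p ^ (m - t)) : ℕ)
      = ((p : ℤ) ^ t - 1) * ((p : ℤ) ^ (2 * m) - p ^ m) := by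
    rw [Nat.cast_mul, hp1, Nat.cast_sub (Nat.pow_le_pow_right hp.pos (by omega))]
    push_cast
    linear_combination ((p : ℤ) ^ t - 1) * (hpn - hpm)
  have hv₂ : (p : ℤ) ^ t * ((p ^ t - 1) * p ^ (2 * m - t) : ℕ)
      = ((p : ℤ) ^ t - 1) * ((p : ℤ) ^ (2 * m) - 0) := by
    rw [Nat.cast_mul, hp1]
    push_cast
    linear_combination ((p : ℤ) ^ t - 1) * hpn
  have hv₃ : (p : ℤ) ^ t * ((p ^ t - 1) * (p ^ (2 * m - t) + p ^ (m - t)) : ℕ)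
      = ((p : ℤ) ^ t - 1) * ((p : ℤ) ^ (2 * m) - -p ^ m) := by
    rw [Nat.cast_mul, hp1]
    push_cast
    linear_combination ((p : ℤ) ^ t - 1) * (hpn + hpm)
  have hv₄ : (p : ℤ) ^ t * ((p ^ t - 1) * (p ^ (2 * m - t) + p ^ (m + d - t)) : ℕ)
      = ((p : ℤ) ^ t - 1) * ((p : ℤ) ^ (2 * m) - -(p ^ m * p ^ d)) := by
    rw [Nat.cast_mul, hp1]
    push_cast
    linear_combination ((p : ℤ) ^ t - 1) * (hpn + hpmd)
  have hv₅ : (p : ℤ) ^ t * (0 : ℕ) = ((p : ℤ) ^ t - 1) * ((p : ℤ) ^ (2 * m) - Fintype.card F) := by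
    rw [hF]; push_cast; ring
  have he : (Fintype.card (fixedSub (frobPow K F (m / t))) : ℤ) = (p : ℤ) ^ m := by
    rw [hcE]; push_cast; rfl
  have hl : (Fintype.card (CommutingPair.commonFixed (frobPow K F (k / t))
      (frobPow K F (m / t))) : ℤ) = (p : ℤ) ^ d := by
    rw [hcS]; push_cast; rfl
  have count {v : ℕ} {τ : ℤ} := wt1count_eq_card_pairsWith hK hp.one_lt ht0 htm hm htk h2 hF hπ
    (v := v) (τ := τ)
  have hl0 : (p : ℤ) ^ d ≠ 0 := pow_ne_zero _ hp0.ne'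
  have hlm : (p : ℤ) ^ (m - d) * p ^ d = p ^ m := by rw [← pow_add]; congr 1; omega
  have hln : (p : ℤ) ^ (2 * m - d) * p ^ d = (p ^ m) ^ 2 := by
    rw [← pow_add, ← pow_mul]; congr 1; omega
  have hn2 : (p : ℤ) ^ (2 * m) = (p ^ m) ^ 2 := by rw [← pow_mul, mul_comm]
  have hd2 : (p : ℤ) ^ (2 * d) = (p ^ d) ^ 2 := by rw [← pow_mul, mul_comm]
  refine ⟨?_, ?_, ?_, ?_, ?_, fun α β hα => ?_⟩
  · rw [count hv₁, h.card_pairsWith_self hψ hν he hl]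
  · rw [count hv₂]
    apply mul_right_cancel₀ hl0
    rw [h.card_pairsWith_zero hψ hν he hl, hn2]
    linear_combination -(((p : ℤ) ^ m) ^ 2 - 1) * hlm
  · rw [count hv₃]
    apply mul_right_cancel₀ hl0
    rw [hn2]
    linear_combination h.card_pairsWith_neg hψ hν he hl
      + 2 * (p : ℤ) ^ d * ((p : ℤ) ^ m - 1) * hln
  · rw [count hv₄, hn2, hd2]
    apply mul_right_cancel₀ hl0
    linear_combination h.card_pairsWith_neg_mul hψ hν he hl
      - (((p : ℤ) ^ m) ^ 2 - 1) * hlm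
  · rw [count hv₅, h.pairsWith_card hψ hν, Finset.card_singleton]
  · have mem {v : ℕ} {τ : ℤ} := wt1_eq_iff_mem_pairsWith hK hp.one_lt ht0 htm hm htk h2 hF hπ
      (v := v) (τ := τ)
    have hcases := h.mem_pairsWith_cases hψ hν (ab := (α, β)) (by rwa [frobPow_apply hK htm])
    rw [he, hl, mem hv₁, mem hv₂, mem hv₃, mem hv₄, mem hv₅] at hcases
    exact hcases.imp And.right (Or.imp And.right (Or.imp And.right (Or.imp And.right And.right)))
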